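/- arXiv:1604.08388 — 4 statements merged into one kernel-verified Lean document; each statement's English description precedes it below -/
import Mathlib

section
/- Let d ≥ 1, ε > 0, T > 0. Let f : [0,T] × ℝ^d × ℝ^d → ℝ be smooth, with f(t,·,·) Schwartz class uniformly for t ∈ [0,T], solving the scaled Vlasov–Fokker–Planck equation ε ∂_t f + v·∇_x f = ε^{-1} ∇_v·(∇_v f + v f) on (0,T) × ℝ^d × ℝ^d. Then for every smooth compactly supported ψ : ℝ × ℝ^d → ℝ and every t ∈ (0,T), (d/dt) ∫_{ℝ^d} ∫_{ℝ^d} f(t,x,v) ψ(t, x + εv) dv dx = ∫_{ℝ^d} ∫_{ℝ^d} f(t,x,v) (∂_t ψ + Δ_x ψ)(t, x + εv) dv dx. -/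
open MeasureTheory Real Set Filter Topology
open scoped ENNReal RealInnerProductSpace

noncomputable section

abbrev Eu (d : ℕ) := EuclideanSpace ℝ (Fin d)

/-- Standard basis vector of `ℝ^d`. -/
def basisE (d : ℕ) (i : Fin d) : Eu d := EuclideanSpace.single i 1

/-- Laplacian of a scalar function on `ℝ^d`. -/
def lapE {d : ℕ} (f : Eu d → ℝ) (x : Eu d) : ℝ :=
  ∑ i, fderiv ℝ (fun y => fderiv ℝ f y (basisE d i)) x (basisE d i)

/-- Divergence of a vector field on `ℝ^d`. -/
def divE {d : ℕ} (F : Eu d → Eu d) (x : Eu d) : ℝ :=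
  ∑ i, fderiv ℝ (fun y => F y i) x (basisE d i)

open SchwartzMap in
theorem SchwartzMap.integrable_mul_of_hasTemperateGrowth {E : Type*} [NormedAddCommGroup E]
    [NormedSpace ℝ E] [FiniteDimensional ℝ E] [MeasurableSpace E] [BorelSpace E]
    (μ : Measure E) [μ.IsAddHaarMeasure] (g : 𝓢(E, ℝ)) {φ : E → ℝ}
    (hφ : φ.HasTemperateGrowth) : Integrable (fun p => g p * φ p) μ := by
  refine (SchwartzMap.integrable (μ := μ) (smulLeftCLM ℝ φ g)).congr (.of_forall fun p => ?_)
  simp [smulLeftCLM_apply_apply hφ, mul_comm]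

open LineDeriv SchwartzMap in
/-- Integration by parts of a Schwartz function against a function of temperate growth. -/
theorem SchwartzMap.integral_lineDerivOp_mul_eq_neg {E : Type*} [NormedAddCommGroup E]
    [NormedSpace ℝ E] [FiniteDimensional ℝ E] [MeasurableSpace E] [BorelSpace E]
    (μ : Measure E) [μ.IsAddHaarMeasure] (g : 𝓢(E, ℝ)) {φ φ' : E → ℝ} (w : E)
    (hφ : φ.HasTemperateGrowth) (hφ' : φ'.HasTemperateGrowth)
    (h : ∀ p, fderiv ℝ φ p w = φ' p) :
    ∫ p, ∂_{w} g p * φ p ∂μ = -∫ p, g p * φ' p ∂μ := by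
  have key := integral_mul_fderiv_eq_neg_fderiv_mul_of_integrable (μ := μ) (f := g) (g := φ)
    (v := w) (by simpa only [lineDerivOp_apply_eq_fderiv] using integrable_mul_of_hasTemperateGrowth μ (∂_{w} g) hφ)
    (by simpa only [h] using integrable_mul_of_hasTemperateGrowth μ g hφ') (integrable_mul_of_hasTemperateGrowth μ g hφ)
    (fun x _ => g.differentiableAt) (fun x _ => (hφ.1.differentiable (by simp)) x)
  simp only [h] at key
  simp only [lineDerivOp_apply_eq_fderiv]
  linarith

open SchwartzMap in
/-- A time slice of a smooth function whose derivatives decay rapidly on that slice is Schwartz. -/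
theorem exists_schwartzMap_slice {E : Type*} [NormedAddCommGroup E] [NormedSpace ℝ E]
    {F : ℝ × E → ℝ} (hF : ContDiff ℝ (⊤ : ℕ∞) F) (t : ℝ)
    (h : ∀ k m : ℕ, ∃ C : ℝ, ∀ p : E, ‖p‖ ^ k * ‖iteratedFDeriv ℝ m F (t, p)‖ ≤ C) :
    ∃ g : 𝓢(E, ℝ), ∀ p, g p = F (t, p) := by
  have hG : ContDiff ℝ (⊤ : ℕ∞) (fun z : ℝ × E => F ((t, 0) + z)) := by fun_prop
  refine ⟨⟨fun p => F (t, p), by fun_prop, fun k m => ?_⟩, fun p => rfl⟩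
  obtain ⟨C, hC⟩ := h k m
  refine ⟨C * ‖ContinuousLinearMap.inr ℝ ℝ E‖ ^ m, fun p => ?_⟩
  have e : (fun p : E => F (t, p)) =
      (fun z : ℝ × E => F ((t, 0) + z)) ∘ ContinuousLinearMap.inr ℝ ℝ E := by
    ext p; simp
  rw [e, (ContinuousLinearMap.inr ℝ ℝ E).iteratedFDeriv_comp_right hG p (mod_cast le_top),
    iteratedFDeriv_comp_add_left]
  have e2 : ((t, 0) : ℝ × E) + ContinuousLinearMap.inr ℝ ℝ E p = (t, p) := by simp
  rw [e2]
  have := ContinuousMultilinearMap.norm_compContinuousLinearMap_le (iteratedFDeriv ℝ m F (t, p))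
    (fun _ => ContinuousLinearMap.inr ℝ ℝ E)
  rw [Finset.prod_const, Finset.card_univ, Fintype.card_fin] at this
  calc _ ≤ ‖p‖ ^ k * (‖iteratedFDeriv ℝ m F (t, p)‖ * ‖ContinuousLinearMap.inr ℝ ℝ E‖ ^ m) := by
        gcongr
    _ = (‖p‖ ^ k * ‖iteratedFDeriv ℝ m F (t, p)‖) * ‖ContinuousLinearMap.inr ℝ ℝ E‖ ^ m := by ring
    _ ≤ _ := by gcongr; exact hC p

/-- Differentiation under the integral sign for a rapidly decaying family tested against a bounded
family with bounded derivative. -/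
theorem hasDerivAt_integral_mul_of_rapid_decay {E : Type*} [NormedAddCommGroup E]
    [NormedSpace ℝ E] [FiniteDimensional ℝ E] [MeasurableSpace E] [BorelSpace E]
    (μ : Measure E) [μ.IsAddHaarMeasure] {F φ : ℝ × E → ℝ}
    (hF : ContDiff ℝ (⊤ : ℕ∞) F) (hφ : ContDiff ℝ (⊤ : ℕ∞) φ) {s : Set ℝ}
    (h : ∀ k m : ℕ, ∃ C : ℝ, ∀ t ∈ s, ∀ p : E, ‖p‖ ^ k * ‖iteratedFDeriv ℝ m F (t, p)‖ ≤ C)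
    {B₀ B₁ : ℝ} (hB₀ : ∀ q, ‖φ q‖ ≤ B₀) (hB₁ : ∀ t p, ‖deriv (fun r => φ (r, p)) t‖ ≤ B₁)
    {t : ℝ} (ht : s ∈ 𝓝 t) :
    HasDerivAt (fun r => ∫ p, F (r, p) * φ (r, p) ∂μ)
      (∫ p, (deriv (fun r => F (r, p)) t * φ (t, p) + F (t, p) * deriv (fun r => φ (r, p)) t) ∂μ)
      t := by
  have hder {G : ℝ × E → ℝ} (hG : ContDiff ℝ (⊤ : ℕ∞) G) (r : ℝ) (p : E) :
      HasDerivAt (fun r => G (r, p)) (fderiv ℝ G (r, p) (1, 0)) r := by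
    have h1 : HasFDerivAt G (fderiv ℝ G (r, p)) (r, p) :=
      (hG.differentiable (by simp) _).hasFDerivAt
    exact h1.comp_hasDerivAt r ((hasDerivAt_id r).prodMk (hasDerivAt_const r p))
  have hcont {G : ℝ × E → ℝ} (hG : ContDiff ℝ (⊤ : ℕ∞) G) :
      Continuous (fun p => deriv (fun r => G (r, p)) t) := by
    simp only [(hder hG t _).deriv]
    have := hG.continuous_fderiv (by simp)
    fun_prop
  have hFc := hF.continuous
  have hφc := hφ.continuous
  have hF'c := hcont hF
  have hφ'c := hcont hφ
  set N : ℕ := Module.finrank ℝ E + 1 with hN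
  have decay (m : ℕ) : ∃ C : ℝ, ∀ r ∈ s, ∀ p : E,
      ‖iteratedFDeriv ℝ m F (r, p)‖ ≤ C * (1 + ‖p‖) ^ (-(N : ℝ)) := by
    obtain ⟨C₀, hC₀⟩ := h 0 m
    obtain ⟨C₁, hC₁⟩ := h N m
    refine ⟨2 ^ (N - 1) * (C₀ + C₁), fun r hr p => ?_⟩
    have h0 := hC₀ r hr p
    have h1 := hC₁ r hr p
    have h2 := add_pow_le zero_le_one (norm_nonneg p) N
    rw [rpow_neg (by positivity), rpow_natCast, ← div_eq_mul_inv, le_div_iff₀ (by positivity)]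
    calc _ ≤ ‖iteratedFDeriv ℝ m F (r, p)‖ * (2 ^ (N - 1) * (1 ^ N + ‖p‖ ^ N)) := by gcongr
      _ = 2 ^ (N - 1) * (‖p‖ ^ 0 * ‖iteratedFDeriv ℝ m F (r, p)‖ +
          ‖p‖ ^ N * ‖iteratedFDeriv ℝ m F (r, p)‖) := by ring
      _ ≤ _ := by gcongr
  obtain ⟨C₀, hC₀⟩ := decay 0
  obtain ⟨C₁, hC₁⟩ := decay 1
  have hF0 : ∀ r ∈ s, ∀ p, ‖F (r, p)‖ ≤ C₀ * (1 + ‖p‖) ^ (-(N : ℝ)) := fun r hr p => by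
    simpa using hC₀ r hr p
  have hF1 : ∀ r ∈ s, ∀ p, ‖deriv (fun r => F (r, p)) r‖ ≤ C₁ * (1 + ‖p‖) ^ (-(N : ℝ)) := by
    intro r hr p
    rw [(hder hF r p).deriv]
    have h1 := hC₁ r hr p
    rw [norm_iteratedFDeriv_one] at h1
    refine ((fderiv ℝ F (r, p)).le_opNorm _).trans (le_trans ?_ h1)
    simp [Prod.norm_def]
  have hint : Integrable (fun p : E => (1 + ‖p‖) ^ (-(N : ℝ))) μ :=
    integrable_one_add_norm (by rw [hN]; push_cast; linarith)
  have hB0 : 0 ≤ B₀ := (norm_nonneg _).trans (hB₀ 0)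
  refine (hasDerivAt_integral_of_dominated_loc_of_deriv_le (s := s)
    (F := fun r p => F (r, p) * φ (r, p))
    (F' := fun r p => deriv (fun r => F (r, p)) r * φ (r, p) +
      F (r, p) * deriv (fun r => φ (r, p)) r)
    (bound := fun p => (C₁ * B₀ + C₀ * B₁) * (1 + ‖p‖) ^ (-(N : ℝ))) ht
    (.of_forall fun r => ?_) ?_ ?_ (.of_forall fun p r hr => ?_) (hint.const_mul _)
    (.of_forall fun p r _ => ?_)).2
  · exact Continuous.aestronglyMeasurable (by fun_prop)
  · refine (hint.const_mul (C₀ * B₀)).mono' (Continuous.aestronglyMeasurable (by fun_prop))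
      (.of_forall fun p => ?_)
    rw [norm_mul]
    calc _ ≤ (C₀ * (1 + ‖p‖) ^ (-(N : ℝ))) * B₀ :=
          mul_le_mul (hF0 t (mem_of_mem_nhds ht) p) (hB₀ _) (norm_nonneg _)
            ((norm_nonneg _).trans (hF0 t (mem_of_mem_nhds ht) p))
      _ = _ := by ring
  · exact Continuous.aestronglyMeasurable (by fun_prop)
  · refine (norm_add_le _ _).trans ?_
    rw [norm_mul, norm_mul]
    calc _ ≤ (C₁ * (1 + ‖p‖) ^ (-(N : ℝ))) * B₀ + (C₀ * (1 + ‖p‖) ^ (-(N : ℝ))) * B₁ :=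
          add_le_add (mul_le_mul (hF1 r hr p) (hB₀ _) (norm_nonneg _)
            ((norm_nonneg _).trans (hF1 r hr p)))
          (mul_le_mul (hF0 r hr p) (hB₁ _ _) (norm_nonneg _)
            ((norm_nonneg _).trans (hF0 r hr p)))
      _ = _ := by ring
  · exact (hder hF r p).differentiableAt.hasDerivAt.mul
      (hder hφ r p).differentiableAt.hasDerivAt

instance instIsAddHaarMeasureVolumeProd (d : ℕ) :
    (volume : Measure (Eu d × Eu d)).IsAddHaarMeasure :=
  inferInstanceAs ((volume : Measure (Eu d)).prod (volume : Measure (Eu d))).IsAddHaarMeasure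

theorem sum_coord_smul_basisE {d : ℕ} (v : Eu d) : ∑ i, v i • basisE d i = v := by
  simpa [basisE] using (EuclideanSpace.basisFun (Fin d) ℝ).sum_repr v

theorem gradient_coord {d : ℕ} {u : Eu d → ℝ} (w : Eu d) (i : Fin d) :
    gradient u w i = fderiv ℝ u w (basisE d i) := by
  rw [← toDual_gradient (𝕜 := ℝ), InnerProductSpace.toDual_apply_apply, basisE,
    EuclideanSpace.inner_single_right]
  simp

open SchwartzMap in
theorem fderiv_slice_snd {d : ℕ} (g : 𝓢(Eu d × Eu d, ℝ)) (x v e : Eu d) :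
    fderiv ℝ (fun w => g (x, w)) v e = fderiv ℝ g (x, v) (0, e) := by
  have h : HasFDerivAt (fun w => g (x, w)) _ v :=
    (g.differentiableAt (x := (x, v))).hasFDerivAt.comp v (hasFDerivAt_prodMk_right x v)
  simp [h.fderiv]

open SchwartzMap in
theorem fderiv_slice_fst {d : ℕ} (g : 𝓢(Eu d × Eu d, ℝ)) (x v e : Eu d) :
    fderiv ℝ (fun y => g (y, v)) x e = fderiv ℝ g (x, v) (e, 0) := by
  have h : HasFDerivAt (fun y => g (y, v)) _ x :=
    (g.differentiableAt (x := (x, v))).hasFDerivAt.comp x (hasFDerivAt_prodMk_left x v)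
  simp [h.fderiv]

theorem hasTemperateGrowth_snd_coord {d : ℕ} (i : Fin d) :
    (fun p : Eu d × Eu d => p.2 i).HasTemperateGrowth :=
  ((EuclideanSpace.proj i : Eu d →L[ℝ] ℝ) ∘L
    ContinuousLinearMap.snd ℝ (Eu d) (Eu d)).hasTemperateGrowth

open SchwartzMap in
/-- Multiplication of a Schwartz function on phase space by the `i`-th velocity coordinate. -/
def velMul {d : ℕ} (i : Fin d) (g : 𝓢(Eu d × Eu d, ℝ)) : 𝓢(Eu d × Eu d, ℝ) :=
  smulLeftCLM ℝ (fun p : Eu d × Eu d => p.2 i) g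

open SchwartzMap in
theorem velMul_apply {d : ℕ} (i : Fin d) (g : 𝓢(Eu d × Eu d, ℝ)) (p : Eu d × Eu d) :
    velMul i g p = p.2 i * g p := by
  simp [velMul, smulLeftCLM_apply_apply (hasTemperateGrowth_snd_coord i)]

open SchwartzMap LineDeriv in
/-- The scaled Vlasov–Fokker–Planck right-hand side, written with the second velocity derivatives
and the derivatives in the directions `(-ε eᵢ, eᵢ)`, along which `x + ε v` is constant. -/
theorem transport_fokkerPlanck_eq_sum {d : ℕ} {ε : ℝ} (hε : 0 < ε) (g : 𝓢(Eu d × Eu d, ℝ))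
    {a : ℝ} (x v : Eu d)
    (h : ε * a + fderiv ℝ (fun y => g (y, v)) x v
      = ε⁻¹ * divE (fun w => gradient (fun u => g (x, u)) w + g (x, w) • w) v) :
    a = ε⁻¹ ^ 2 * ∑ i, (∂_{((-ε) • basisE d i, basisE d i)} (velMul i g) (x, v)
      + ∂_{((0 : Eu d), basisE d i)} (∂_{((0 : Eu d), basisE d i)} g) (x, v)) := by
  have hdiv : divE (fun w => gradient (fun u => g (x, u)) w + g (x, w) • w) v
      = ∑ i, (∂_{((0 : Eu d), basisE d i)} (∂_{((0 : Eu d), basisE d i)} g) (x, v)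
        + ∂_{((0 : Eu d), basisE d i)} (velMul i g) (x, v)) := by
    refine Finset.sum_congr rfl fun i _ => ?_
    have e : (fun w => (gradient (fun u => g (x, u)) w + g (x, w) • w) i)
        = fun w => (∂_{((0 : Eu d), basisE d i)} g + velMul i g) (x, w) := by
      ext w
      rw [PiLp.add_apply, gradient_coord, fderiv_slice_snd, PiLp.smul_apply, smul_eq_mul,
        add_apply, lineDerivOp_apply_eq_fderiv, velMul_apply, mul_comm]
    rw [e, fderiv_slice_snd, ← lineDerivOp_apply_eq_fderiv, lineDerivOp_add,
      add_apply]
  have htr : fderiv ℝ (fun y => g (y, v)) x v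
      = ∑ i, ∂_{(basisE d i, (0 : Eu d))} (velMul i g) (x, v) := by
    conv_lhs => rw [← sum_coord_smul_basisE v]
    rw [map_sum]
    refine Finset.sum_congr rfl fun i _ => ?_
    rw [lineDerivOp_apply_eq_fderiv, ← fderiv_slice_fst]
    simp only [velMul_apply]
    have hd : DifferentiableAt ℝ (fun y => g (y, v)) x :=
      (g.differentiableAt (x := (x, v))).comp x (by fun_prop)
    rw [fderiv_const_mul hd, sum_coord_smul_basisE]
    simp
  have hdir (i : Fin d) : ∂_{((-ε) • basisE d i, basisE d i)} (velMul i g) (x, v)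
      = ∂_{((0 : Eu d), basisE d i)} (velMul i g) (x, v)
        - ε * ∂_{(basisE d i, (0 : Eu d))} (velMul i g) (x, v) := by
    have e : ((-ε) • basisE d i, basisE d i)
        = ((0 : Eu d), basisE d i) - ε • (basisE d i, (0 : Eu d)) := by
      ext <;> simp
    simp only [lineDerivOp_apply_eq_fderiv]
    rw [e, map_sub, map_smul, smul_eq_mul]
  rw [hdiv, htr] at h
  simp only [hdir]
  simp only [Finset.sum_add_distrib, Finset.sum_sub_distrib, ← Finset.mul_sum] at h ⊢
  field_simp at h ⊢
  linarith

/-- The map `(x, v) ↦ (t, x + ε v)`. -/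
def shearAt {d : ℕ} (ε t : ℝ) (p : Eu d × Eu d) : ℝ × Eu d := (t, p.1 + ε • p.2)

theorem hasFDerivAt_shearAt {d : ℕ} (ε t : ℝ) (p : Eu d × Eu d) :
    HasFDerivAt (shearAt ε t) ((0 : Eu d × Eu d →L[ℝ] ℝ).prod
      (ContinuousLinearMap.fst ℝ _ _ + ε • ContinuousLinearMap.snd ℝ _ _)) p :=
  (hasFDerivAt_const t p).prodMk (hasFDerivAt_fst.add (hasFDerivAt_snd.const_smul ε))

open SchwartzMap in
theorem SchwartzMap.hasTemperateGrowth_comp_shearAt {d : ℕ} (ε t : ℝ) (Ψ : 𝓢(ℝ × Eu d, ℝ)) :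
    (fun p => Ψ (shearAt ε t p)).HasTemperateGrowth := by
  have e : (shearAt ε t : Eu d × Eu d → ℝ × Eu d) = (fun _ : Eu d × Eu d => ((t, 0) : ℝ × Eu d)) +
      ⇑((0 : Eu d × Eu d →L[ℝ] ℝ).prod (ContinuousLinearMap.fst ℝ (Eu d) (Eu d) +
        ε • ContinuousLinearMap.snd ℝ (Eu d) (Eu d))) := by
    ext p <;> simp [shearAt]
  refine Ψ.hasTemperateGrowth.comp ?_
  rw [e]
  exact (Function.HasTemperateGrowth.const _).add (ContinuousLinearMap.hasTemperateGrowth _)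

open SchwartzMap LineDeriv in
theorem SchwartzMap.fderiv_comp_shearAt {d : ℕ} (ε t : ℝ) (Ψ : 𝓢(ℝ × Eu d, ℝ))
    (p w : Eu d × Eu d) :
    fderiv ℝ (fun p => Ψ (shearAt ε t p)) p w
      = ∂_{((0 : ℝ), w.1 + ε • w.2)} Ψ (shearAt ε t p) := by
  have h : HasFDerivAt (fun p => Ψ (shearAt ε t p)) _ p :=
    Ψ.differentiableAt.hasFDerivAt.comp p (hasFDerivAt_shearAt ε t p)
  rw [h.fderiv, lineDerivOp_apply_eq_fderiv]
  simp

open SchwartzMap LineDeriv in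
theorem lapE_schwartzMap_slice {d : ℕ} (Ψ : 𝓢(ℝ × Eu d, ℝ)) (t : ℝ) (y : Eu d) :
    lapE (fun y => Ψ (t, y)) y
      = ∑ i, ∂_{((0 : ℝ), basisE d i)} (∂_{((0 : ℝ), basisE d i)} Ψ) (t, y) := by
  have hs (Φ : 𝓢(ℝ × Eu d, ℝ)) (y e : Eu d) :
      fderiv ℝ (fun y => Φ (t, y)) y e = ∂_{((0 : ℝ), e)} Φ (t, y) := by
    have h : HasFDerivAt (fun y => Φ (t, y)) _ y :=
      (Φ.differentiableAt (x := (t, y))).hasFDerivAt.comp y (hasFDerivAt_prodMk_right t y)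
    rw [h.fderiv, lineDerivOp_apply_eq_fderiv]
    simp
  simp only [lapE, hs]

open SchwartzMap LineDeriv in
theorem SchwartzMap.deriv_slice_fst {E : Type*} [NormedAddCommGroup E] [NormedSpace ℝ E]
    (Ψ : 𝓢(ℝ × E, ℝ)) (t : ℝ) (y : E) :
    deriv (fun s => Ψ (s, y)) t = ∂_{((1 : ℝ), (0 : E))} Ψ (t, y) :=
  ((Ψ.differentiableAt (x := (t, y))).hasFDerivAt.comp_hasDerivAt t
    ((hasDerivAt_id t).prodMk (hasDerivAt_const t y))).deriv

open SchwartzMap LineDeriv in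
/-- Weak form of the right-hand side of the scaled equation, tested against `Ψ (t, x + ε v)`. -/
theorem integral_transport_fokkerPlanck_mul {d : ℕ} {ε : ℝ} (hε : 0 < ε) (t : ℝ)
    (g : 𝓢(Eu d × Eu d, ℝ)) (Ψ : 𝓢(ℝ × Eu d, ℝ)) :
    Integrable (fun p => (ε⁻¹ ^ 2 * ∑ i, (∂_{((-ε) • basisE d i, basisE d i)} (velMul i g) p
        + ∂_{((0 : Eu d), basisE d i)} (∂_{((0 : Eu d), basisE d i)} g) p)) *
          Ψ (shearAt ε t p)) ∧
    ∫ p, (ε⁻¹ ^ 2 * ∑ i, (∂_{((-ε) • basisE d i, basisE d i)} (velMul i g) p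
        + ∂_{((0 : Eu d), basisE d i)} (∂_{((0 : Eu d), basisE d i)} g) p)) * Ψ (shearAt ε t p)
      = ∫ p, g p * ∑ i, ∂_{((0 : ℝ), basisE d i)} (∂_{((0 : ℝ), basisE d i)} Ψ)
          (shearAt ε t p) := by
  have htg (Φ : 𝓢(ℝ × Eu d, ℝ)) := Φ.hasTemperateGrowth_comp_shearAt ε t
  have hint (u : 𝓢(Eu d × Eu d, ℝ)) (Φ : 𝓢(ℝ × Eu d, ℝ)) :
      Integrable (fun p => u p * Φ (shearAt ε t p)) :=
    integrable_mul_of_hasTemperateGrowth volume u (htg Φ)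
  have h1 (i : Fin d) :
      ∫ p, ∂_{((-ε) • basisE d i, basisE d i)} (velMul i g) p * Ψ (shearAt ε t p) = 0 := by
    rw [integral_lineDerivOp_mul_eq_neg volume (velMul i g) _ (htg Ψ)
      (Function.HasTemperateGrowth.const 0) fun p => ?_]
    · simp
    · rw [fderiv_comp_shearAt, lineDerivOp_apply_eq_fderiv]
      simp [← Prod.zero_eq_mk]
  have hv (u : 𝓢(Eu d × Eu d, ℝ)) (Φ : 𝓢(ℝ × Eu d, ℝ)) (i : Fin d) :
      ∫ p, ∂_{((0 : Eu d), basisE d i)} u p * Φ (shearAt ε t p)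
        = -(ε * ∫ p, u p * ∂_{((0 : ℝ), basisE d i)} Φ (shearAt ε t p)) := by
    rw [integral_lineDerivOp_mul_eq_neg volume u _ (htg Φ) (htg (ε • ∂_{((0 : ℝ), basisE d i)} Φ))
      fun p => ?_, ← integral_const_mul]
    · congr 2
      ext p
      simp only [smul_apply, smul_eq_mul]
      ring
    · rw [fderiv_comp_shearAt, smul_apply, lineDerivOp_apply_eq_fderiv,
        lineDerivOp_apply_eq_fderiv, ← map_smul]
      simp
  have hsum (i : Fin d) :
      Integrable (fun p => ∂_{((-ε) • basisE d i, basisE d i)} (velMul i g) p * Ψ (shearAt ε t p)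
        + ∂_{((0 : Eu d), basisE d i)} (∂_{((0 : Eu d), basisE d i)} g) p
          * Ψ (shearAt ε t p)) := (hint _ _).add (hint _ _)
  simp only [mul_assoc, Finset.sum_mul, add_mul]
  refine ⟨(integrable_finsetSum _ fun i _ => hsum i).const_mul _, ?_⟩
  rw [integral_const_mul, integral_finsetSum _ fun i _ => hsum i]
  simp only [Finset.mul_sum]
  rw [integral_finsetSum _ fun i _ => hint _ _]
  refine Finset.sum_congr rfl fun i _ => ?_
  rw [integral_add (hint _ _) (hint _ _), h1, hv, hv]
  field_simp
  ring

open LineDeriv in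
/-- for a smooth, uniformly-in-time Schwartz-class solution `f` of the
scaled Vlasov–Fokker–Planck equation in the whole space and any smooth compactly
supported `ψ`,
`(d/dt) ∫∫ f ψ(t, x+εv) dv dx = ∫∫ f (∂_t ψ + Δ_x ψ)(t, x+εv) dv dx` on `(0,T)`. -/
theorem statement8 (d : ℕ) (hd : 1 ≤ d) (ε T : ℝ) (hε : 0 < ε) (hT : 0 < T)
    (f : ℝ → Eu d → Eu d → ℝ)
    (hsmooth : ContDiff ℝ (⊤ : ℕ∞) (fun p : ℝ × Eu d × Eu d => f p.1 p.2.1 p.2.2))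
    (hschwartz : ∀ k m : ℕ, ∃ Ckm : ℝ, ∀ t ∈ Icc (0 : ℝ) T, ∀ p : Eu d × Eu d,
      ‖p‖ ^ k *
        ‖iteratedFDeriv ℝ m (fun q : ℝ × Eu d × Eu d => f q.1 q.2.1 q.2.2) (t, p)‖ ≤ Ckm)
    (hpde : ∀ t ∈ Ioo (0 : ℝ) T, ∀ x v : Eu d,
      ε * deriv (fun s => f s x v) t + fderiv ℝ (fun y => f t y v) x v
        = ε⁻¹ * divE (fun w => gradient (fun u => f t x u) w + f t x w • w) v)
    (ψ : ℝ × Eu d → ℝ) (hψ : ContDiff ℝ (⊤ : ℕ∞) ψ) (hψc : HasCompactSupport ψ) :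
    ∀ t ∈ Ioo (0 : ℝ) T,
      HasDerivAt (fun s => ∫ x : Eu d, ∫ v : Eu d, f s x v * ψ (s, x + ε • v))
        (∫ x : Eu d, ∫ v : Eu d, f t x v *
          (deriv (fun s => ψ (s, x + ε • v)) t + lapE (fun y => ψ (t, y)) (x + ε • v)))
        t := by
  intro t ht
  set F : ℝ × (Eu d × Eu d) → ℝ := fun q => f q.1 q.2.1 q.2.2 with hFdef
  let Ψ : SchwartzMap (ℝ × Eu d) ℝ := hψc.toSchwartzMap hψ
  have hΨ : ∀ q, ψ q = Ψ q := fun _ => rfl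
  have hslice (s : ℝ) (hs : s ∈ Icc 0 T) :
      ∃ g : SchwartzMap (Eu d × Eu d) ℝ, ∀ p, g p = F (s, p) :=
    exists_schwartzMap_slice hsmooth s fun k m =>
      (hschwartz k m).imp fun C hC p => hC s hs p
  have hφ : ContDiff ℝ (⊤ : ℕ∞)
      (fun q : ℝ × (Eu d × Eu d) => ψ (q.1, q.2.1 + ε • q.2.2)) := by fun_prop
  have hmain := hasDerivAt_integral_mul_of_rapid_decay (volume : Measure (Eu d × Eu d))
    (s := Icc 0 T) hsmooth hφ hschwartz
    (B₀ := SchwartzMap.seminorm ℝ 0 0 Ψ)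
    (B₁ := SchwartzMap.seminorm ℝ 0 0 (∂_{((1 : ℝ), (0 : Eu d))} Ψ))
    (fun q => Ψ.norm_le_seminorm ℝ _)
    (fun s p => by
      simp only [hΨ, Ψ.deriv_slice_fst]
      exact SchwartzMap.norm_le_seminorm ℝ _ _)
    (Icc_mem_nhds ht.1 ht.2)
  obtain ⟨g, hg⟩ := hslice t (Ioo_subset_Icc_self ht)
  have hfun : (fun s => ∫ x : Eu d, ∫ v : Eu d, f s x v * ψ (s, x + ε • v)) =ᶠ[𝓝 t]
      fun s => ∫ p : Eu d × Eu d, F (s, p) * ψ (s, p.1 + ε • p.2) := by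
    filter_upwards [Ioo_mem_nhds ht.1 ht.2] with s hs
    obtain ⟨u, hu⟩ := hslice s (Ioo_subset_Icc_self hs)
    have hi : Integrable (fun p : Eu d × Eu d => F (s, p) * ψ (s, p.1 + ε • p.2))
        (volume.prod volume) := by
      simp only [← hu]
      exact u.integrable_mul_of_hasTemperateGrowth volume
        (Ψ.hasTemperateGrowth_comp_shearAt ε s)
    exact (integral_prod _ hi).symm
  refine (hmain.congr_of_eventuallyEq hfun).congr_deriv ?_
  have htg (Φ : SchwartzMap (ℝ × Eu d) ℝ) := Φ.hasTemperateGrowth_comp_shearAt ε t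
  have hlap : (fun p : Eu d × Eu d => ∑ i, ∂_{((0 : ℝ), basisE d i)}
      (∂_{((0 : ℝ), basisE d i)} Ψ) (shearAt ε t p)).HasTemperateGrowth :=
    Function.HasTemperateGrowth.sum fun i _ => htg _
  have hit := g.integrable_mul_of_hasTemperateGrowth volume
    (htg (∂_{((1 : ℝ), (0 : Eu d))} Ψ))
  have hil := g.integrable_mul_of_hasTemperateGrowth volume hlap
  have hR : ∫ x : Eu d, ∫ v : Eu d, f t x v *
      (deriv (fun s => ψ (s, x + ε • v)) t + lapE (fun y => ψ (t, y)) (x + ε • v))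
      = ∫ p : Eu d × Eu d, (g p * ∂_{((1 : ℝ), (0 : Eu d))} Ψ (shearAt ε t p) +
        g p * ∑ i, ∂_{((0 : ℝ), basisE d i)} (∂_{((0 : ℝ), basisE d i)} Ψ) (shearAt ε t p)) := by
    refine Eq.trans ?_ (integral_prod _ (hit.add hil)).symm
    congr with x
    congr with v
    simp only [hΨ, Ψ.deriv_slice_fst, lapE_schwartzMap_slice, Pi.add_apply, hg, hFdef, shearAt]
    ring
  have htime (p : Eu d × Eu d) := transport_fokkerPlanck_eq_sum hε g p.1 p.2
    (a := deriv (fun s => F (s, p)) t) (by simpa only [hg, hFdef] using hpde t ht p.1 p.2)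
  obtain ⟨hid, hweak⟩ := integral_transport_fokkerPlanck_mul hε t g Ψ
  rw [hR, integral_add hit hil, ← hweak, add_comm, ← integral_add hid hit]
  congr with p
  simp only [htime, hΨ, Ψ.deriv_slice_fst, hg, shearAt, add_comm]
end
end

section
/- Let d ≥ 1, T > 0, and let f_in : ℝ^d × ℝ^d → ℝ be nonnegative with ∫∫ |f_in|² M(v)^{-1} dv dx < ∞. For each ε > 0 let f^ε : [0,T] × ℝ^d × ℝ^d → ℝ be a smooth solution, Schwartz class in (x,v) uniformly in t, of ε ∂_t f^ε + v·∇_x f^ε = ε^{-1} ∇_v·(∇_v f^ε + v f^ε) with f^ε(0,·,·) = f_in, satisfying the uniform bound sup_{t,ε} ∫∫ |f^ε(t,x,v)|² M(v)^{-1} dv dx < ∞. Suppose that as ε → 0, f^ε converges weakly in L²((0,T) × ℝ^d × ℝ^d, M(v)^{-1} dt dx dv) to ρ(t,x) M(v) for some ρ ∈ L²((0,T) × ℝ^d). Then ρ is a distributional solution of the heat equation ∂_t ρ − Δ_x ρ = 0 with initial datum ρ_in(x) := ∫_{ℝ^d} f_in(x,v) dv, i.e. for every smooth compactly supported φ : [0,T)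 × ℝ^d → ℝ, ∫₀^T ∫_{ℝ^d} ρ (∂_t φ + Δ_x φ) dx dt + ∫_{ℝ^d} ρ_in(x) φ(0,x) dx = 0. -/
open MeasureTheory Real Set Filter Topology
open scoped ENNReal RealInnerProductSpace

noncomputable section

/-- The Maxwellian `M(v) = (2π)^{-d/2} exp(-|v|²/2)`. -/
def gaussM (d : ℕ) (v : Eu d) : ℝ := (2 * π) ^ (-(d : ℝ) / 2) * Real.exp (-‖v‖ ^ 2 / 2)

section RapidDecay

variable {P : Type*} [NormedAddCommGroup P] [NormedSpace ℝ P]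

/-- Smooth functions of `(t, p)` all of whose derivatives decay rapidly in `p`, uniformly for
`t ∈ [0, T]`. -/
def RapidDecay (T : ℝ) (G : ℝ × P → ℝ) : Prop :=
  ContDiff ℝ (⊤ : ℕ∞) G ∧ ∀ k m : ℕ, ∃ C : ℝ, ∀ t ∈ Icc (0 : ℝ) T, ∀ p : P,
    ‖p‖ ^ k * ‖iteratedFDeriv ℝ m G (t, p)‖ ≤ C

variable {T : ℝ} {G H Ψ : ℝ × P → ℝ}

lemma norm_iteratedFDeriv_fderiv_apply_le {X : Type*} [NormedAddCommGroup X] [NormedSpace ℝ X]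
    {G : X → ℝ} (hG : ContDiff ℝ (⊤ : ℕ∞) G) (w q : X) (m : ℕ) :
    ‖iteratedFDeriv ℝ m (fun z => fderiv ℝ G z w) q‖ ≤ ‖w‖ * ‖iteratedFDeriv ℝ (m + 1) G q‖ := by
  rw [← norm_iteratedFDeriv_fderiv]
  exact norm_iteratedFDeriv_clm_apply_const
    (hG.fderiv_right (m := (⊤ : ℕ∞)) (by simp)).contDiffAt (mod_cast le_top)

lemma contDiff_fderiv_apply_const {X : Type*} [NormedAddCommGroup X] [NormedSpace ℝ X]
    {G : X → ℝ} (hG : ContDiff ℝ (⊤ : ℕ∞) G) (w : X) :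
    ContDiff ℝ (⊤ : ℕ∞) (fun z => fderiv ℝ G z w) :=
  (hG.fderiv_right (m := (⊤ : ℕ∞)) (by simp)).clm_apply contDiff_const

lemma Function.HasTemperateGrowth.fderiv_apply_const {X : Type*} [NormedAddCommGroup X]
    [NormedSpace ℝ X] {G : X → ℝ} (hG : Function.HasTemperateGrowth G) (w : X) :
    Function.HasTemperateGrowth (fun z => fderiv ℝ G z w) := by
  refine ⟨contDiff_fderiv_apply_const hG.1 w, fun n => ?_⟩
  obtain ⟨k, C, h⟩ := hG.2 (n + 1)
  refine ⟨k, ‖w‖ * C, fun x => (norm_iteratedFDeriv_fderiv_apply_le hG.1 w x n).trans ?_⟩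
  rw [mul_assoc]
  gcongr
  exact h x

namespace RapidDecay

lemma fderiv_apply_const (hG : RapidDecay T G) (w : ℝ × P) :
    RapidDecay T (fun q => fderiv ℝ G q w) := by
  refine ⟨contDiff_fderiv_apply_const hG.1 w, fun k m => ?_⟩
  obtain ⟨C, h⟩ := hG.2 k (m + 1)
  refine ⟨‖w‖ * C, fun t ht p => ?_⟩
  calc _ ≤ ‖p‖ ^ k * (‖w‖ * ‖iteratedFDeriv ℝ (m + 1) G (t, p)‖) := by
        gcongr; exact norm_iteratedFDeriv_fderiv_apply_le hG.1 w _ m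
    _ = ‖w‖ * (‖p‖ ^ k * ‖iteratedFDeriv ℝ (m + 1) G (t, p)‖) := by ring
    _ ≤ _ := by gcongr; exact h t ht p

lemma add (hG : RapidDecay T G) (hH : RapidDecay T H) : RapidDecay T (fun q => G q + H q) := by
  refine ⟨hG.1.add hH.1, fun k m => ?_⟩
  obtain ⟨C, h⟩ := hG.2 k m
  obtain ⟨D, h'⟩ := hH.2 k m
  refine ⟨C + D, fun t ht p => ?_⟩
  have e : iteratedFDeriv ℝ m (fun q => G q + H q) (t, p)
      = iteratedFDeriv ℝ m G (t, p) + iteratedFDeriv ℝ m H (t, p) :=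
    iteratedFDeriv_add_apply (hG.1.contDiffAt.of_le (mod_cast le_top))
      (hH.1.contDiffAt.of_le (mod_cast le_top))
  rw [e]
  calc _ ≤ ‖p‖ ^ k * (‖iteratedFDeriv ℝ m G (t, p)‖ + ‖iteratedFDeriv ℝ m H (t, p)‖) := by
        gcongr; exact norm_add_le _ _
    _ ≤ _ := by rw [mul_add]; exact add_le_add (h t ht p) (h' t ht p)

lemma mul_temperate (hG : RapidDecay T G) (hΨ : Function.HasTemperateGrowth Ψ) :
    RapidDecay T (fun q => G q * Ψ q) := by
  refine ⟨hG.1.mul hΨ.1, fun k m => ?_⟩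
  have key : ∀ i : ℕ, ∃ C, ∀ t ∈ Icc (0 : ℝ) T, ∀ p : P, ‖p‖ ^ k *
      ((m.choose i : ℝ) * ‖iteratedFDeriv ℝ i G (t, p)‖ *
        ‖iteratedFDeriv ℝ (m - i) Ψ (t, p)‖) ≤ C := by
    intro i
    obtain ⟨l, C, h⟩ := hΨ.2 (m - i)
    obtain ⟨A, hA⟩ := hG.2 k i
    obtain ⟨B, hB⟩ := hG.2 (k + l) i
    refine ⟨m.choose i * (|C| * 2 ^ (l - 1)) * ((1 + T) ^ l * A + B), fun t ht p => ?_⟩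
    have hT : 0 ≤ T := ht.1.trans ht.2
    have hn : 1 + ‖(t, p)‖ ≤ (1 + T) + ‖p‖ := by
      have : ‖(t, p)‖ ≤ T + ‖p‖ := by
        rw [Prod.norm_def]
        refine max_le ?_ ?_
        · simp only [Real.norm_eq_abs, abs_of_nonneg ht.1]
          linarith [ht.2, norm_nonneg p]
        · simpa using hT
      linarith
    have h1 : ‖iteratedFDeriv ℝ (m - i) Ψ (t, p)‖
        ≤ |C| * (2 ^ (l - 1) * ((1 + T) ^ l + ‖p‖ ^ l)) := by
      refine (h _).trans ?_
      calc C * (1 + ‖(t, p)‖) ^ l ≤ |C| * (1 + ‖(t, p)‖) ^ l := by gcongr; exact le_abs_self C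
        _ ≤ |C| * ((1 + T) + ‖p‖) ^ l := by gcongr
        _ ≤ _ := by gcongr; exact add_pow_le (by linarith) (norm_nonneg _) l
    calc _ ≤ ‖p‖ ^ k * ((m.choose i : ℝ) * ‖iteratedFDeriv ℝ i G (t, p)‖ *
        (|C| * (2 ^ (l - 1) * ((1 + T) ^ l + ‖p‖ ^ l)))) := by gcongr
      _ = m.choose i * (|C| * 2 ^ (l - 1)) *
        ((1 + T) ^ l * (‖p‖ ^ k * ‖iteratedFDeriv ℝ i G (t, p)‖)
          + ‖p‖ ^ (k + l) * ‖iteratedFDeriv ℝ i G (t, p)‖) := by ring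
      _ ≤ _ := by
        gcongr
        · exact hA t ht p
        · exact hB t ht p
  choose C hC using key
  refine ⟨∑ i ∈ Finset.range (m + 1), C i, fun t ht p => ?_⟩
  calc _ ≤ ‖p‖ ^ k * ∑ i ∈ Finset.range (m + 1), (m.choose i : ℝ) *
        ‖iteratedFDeriv ℝ i G (t, p)‖ * ‖iteratedFDeriv ℝ (m - i) Ψ (t, p)‖ := by
        gcongr
        exact norm_iteratedFDeriv_mul_le hG.1 hΨ.1 (t, p) (mod_cast le_top)
    _ ≤ _ := by
        rw [Finset.mul_sum]
        exact Finset.sum_le_sum fun i _ => hC i t ht p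

lemma differentiable (hG : RapidDecay T G) : Differentiable ℝ G := hG.1.differentiable (by simp)

lemma hasFDerivAt_slice (hG : RapidDecay T G) (t : ℝ) (p : P) :
    HasFDerivAt (fun z => G (t, z)) ((fderiv ℝ G (t, p)).comp (ContinuousLinearMap.inr ℝ ℝ P)) p :=
  (hG.differentiable (t, p)).hasFDerivAt.comp p (hasFDerivAt_prodMk_right t p)

variable [FiniteDimensional ℝ P] [MeasurableSpace P] [BorelSpace P]
  (μ : Measure P) [μ.IsAddHaarMeasure]

lemma exists_integrable_bound (hG : RapidDecay T G) :
    ∃ b : P → ℝ, Integrable b μ ∧ ∀ t ∈ Icc (0 : ℝ) T, ∀ p, ‖G (t, p)‖ ≤ b p := by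
  set r := μ.integrablePower
  obtain ⟨A, hA⟩ := hG.2 0 0
  obtain ⟨B, hB⟩ := hG.2 (0 + r) 0
  refine ⟨fun p => 2 ^ r * (A + B) * (1 + ‖p‖) ^ (-(r : ℝ)),
    (Measure.integrable_pow_neg_integrablePower μ).const_mul _, fun t ht p => ?_⟩
  have := pow_mul_le_of_le_of_pow_mul_le (k := 0) (l := r) (norm_nonneg p)
    (norm_nonneg (G (t, p))) (by simpa using hA t ht p) (by simpa using hB t ht p)
  simpa using this

lemma integrable_slice (hG : RapidDecay T G) {t : ℝ} (ht : t ∈ Icc (0 : ℝ) T) :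
    Integrable (fun p => G (t, p)) μ := by
  obtain ⟨b, hb, h⟩ := hG.exists_integrable_bound μ
  exact hb.mono' (hG.1.continuous.comp (by fun_prop)).aestronglyMeasurable
    (ae_of_all _ fun p => h t ht p)

lemma integrable_prod (hG : RapidDecay T G) :
    Integrable G ((volume.restrict (Ioo (0 : ℝ) T)).prod μ) := by
  obtain ⟨b, hb, h⟩ := hG.exists_integrable_bound μ
  have h1 : Integrable (fun _ : ℝ => (1 : ℝ)) (volume.restrict (Ioo (0 : ℝ) T)) :=
    integrable_const _
  refine (h1.mul_prod hb).mono' hG.1.continuous.aestronglyMeasurable ?_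
  rw [← Measure.restrict_univ (μ := μ), Measure.prod_restrict]
  filter_upwards [ae_restrict_mem (measurableSet_Ioo.prod MeasurableSet.univ)] with q hq
  simpa using h q.1 ⟨hq.1.1.le, hq.1.2.le⟩ q.2

lemma integral_fderiv_slice_eq_zero (hG : RapidDecay T G) (w : P) {t : ℝ}
    (ht : t ∈ Icc (0 : ℝ) T) : ∫ p, fderiv ℝ G (t, p) ((0 : ℝ), w) ∂μ = 0 := by
  have hd : ∀ p, fderiv ℝ (fun z => G (t, z)) p w = fderiv ℝ G (t, p) (0, w) := fun p => by
    rw [(hG.hasFDerivAt_slice t p).fderiv]; simp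
  have := integral_mul_fderiv_eq_neg_fderiv_mul_of_integrable (μ := μ) (v := w)
    (f := fun _ : P => (1 : ℝ)) (g := fun z => G (t, z)) (by simp)
    (by simpa [hd] using (hG.fderiv_apply_const (0, w)).integrable_slice μ ht)
    (by simpa using hG.integrable_slice μ ht) (fun _ _ => differentiableAt_const _)
    (fun p _ => (hG.hasFDerivAt_slice t p).differentiableAt)
  simpa [hd] using this

lemma integral_fderiv_space_eq_zero (hG : RapidDecay T G) (w : P) :
    ∫ q, fderiv ℝ G q ((0 : ℝ), w) ∂((volume.restrict (Ioo (0 : ℝ) T)).prod μ) = 0 := by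
  rw [integral_prod _ ((hG.fderiv_apply_const (0, w)).integrable_prod μ)]
  refine integral_eq_zero_of_ae ?_
  filter_upwards [ae_restrict_mem measurableSet_Ioo] with t ht
  exact hG.integral_fderiv_slice_eq_zero μ w ⟨ht.1.le, ht.2.le⟩

lemma integral_fderiv_time (hT : 0 ≤ T) (hG : RapidDecay T G) (hG_T : ∀ p, G (T, p) = 0) :
    ∫ q, fderiv ℝ G q ((1 : ℝ), (0 : P)) ∂((volume.restrict (Ioo (0 : ℝ) T)).prod μ)
      = - ∫ p, G (0, p) ∂μ := by
  rw [integral_prod_symm _ ((hG.fderiv_apply_const (1, 0)).integrable_prod μ), ← integral_neg]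
  congr 1 with p
  have hd : ∀ t ∈ uIcc 0 T, HasDerivAt (fun s => G (s, p)) (fderiv ℝ G (t, p) (1, 0)) t := by
    intro t _
    exact (hG.differentiable (t, p)).hasFDerivAt.comp_hasDerivAt t
      ((hasDerivAt_id t).prodMk (hasDerivAt_const t p))
  rw [← integral_Ioc_eq_integral_Ioo, ← intervalIntegral.integral_of_le hT,
    intervalIntegral.integral_eq_sub_of_hasDerivAt hd, hG_T, zero_sub]
  refine Continuous.intervalIntegrable ?_ _ _
  exact (hG.fderiv_apply_const (1, 0)).1.continuous.comp (by fun_prop)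

end RapidDecay

end RapidDecay

section WeakFormulation

variable {d : ℕ}

/-- The direction `∂_{x_i}` in phase space-time. -/
def xDir (i : Fin d) : Eu d × Eu d := (basisE d i, 0)

/-- The direction `∂_{v_i}` in phase space-time. -/
def vDir (i : Fin d) : Eu d × Eu d := (0, basisE d i)

lemma sum_smul_basisE (v : Eu d) : ∑ i, v i • basisE d i = v := by
  simpa [basisE] using (EuclideanSpace.basisFun (Fin d) ℝ).sum_repr v

lemma inner_basisE (u : Eu d) (i : Fin d) : inner ℝ u (basisE d i) = u i := by
  simp [basisE, EuclideanSpace.inner_single_right]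

/-- The velocity coordinate `v_i` on phase space-time. -/
def vCoord (i : Fin d) : ℝ × Eu d × Eu d →L[ℝ] ℝ :=
  (EuclideanSpace.proj i).comp
    ((ContinuousLinearMap.snd ℝ (Eu d) (Eu d)).comp (ContinuousLinearMap.snd ℝ ℝ (Eu d × Eu d)))

@[simp]
lemma vCoord_apply (i : Fin d) (q : ℝ × Eu d × Eu d) : vCoord i q = q.2.2 i := rfl

lemma RapidDecay.integral_fderiv_mul_temperate {T : ℝ} {G Ψ : ℝ × Eu d × Eu d → ℝ}
    (hG : RapidDecay T G) (hΨ : Function.HasTemperateGrowth Ψ) (w : Eu d × Eu d) :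
    ∫ q, fderiv ℝ G q (0, w) * Ψ q
        ∂((volume.restrict (Ioo (0 : ℝ) T)).prod (volume : Measure (Eu d × Eu d)))
      = - ∫ q, G q * fderiv ℝ Ψ q (0, w)
        ∂((volume.restrict (Ioo (0 : ℝ) T)).prod (volume : Measure (Eu d × Eu d))) := by
  have : (volume : Measure (Eu d × Eu d)).IsAddHaarMeasure :=
    inferInstanceAs ((volume : Measure (Eu d)).prod (volume : Measure (Eu d))).IsAddHaarMeasure
  have h := (hG.mul_temperate hΨ).integral_fderiv_space_eq_zero volume w
  have e : ∀ q, fderiv ℝ (fun q => G q * Ψ q) q (0, w)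
      = fderiv ℝ G q (0, w) * Ψ q + G q * fderiv ℝ Ψ q (0, w) := fun q => by
    rw [fderiv_fun_mul (hG.differentiable q) (hΨ.1.differentiable (by simp) q)]
    simp; ring
  simp_rw [e] at h
  rw [integral_add (((hG.fderiv_apply_const _).mul_temperate hΨ).integrable_prod volume)
    ((hG.mul_temperate (hΨ.fderiv_apply_const _)).integrable_prod volume)] at h
  linarith

lemma RapidDecay.integral_fderiv_time_mul_temperate {T : ℝ} {G Ψ : ℝ × Eu d × Eu d → ℝ}
    (hT : 0 ≤ T) (hG : RapidDecay T G) (hΨ : Function.HasTemperateGrowth Ψ)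
    (hΨ_T : ∀ p, Ψ (T, p) = 0) :
    ∫ q, fderiv ℝ G q (1, 0) * Ψ q
        ∂((volume.restrict (Ioo (0 : ℝ) T)).prod (volume : Measure (Eu d × Eu d)))
      = - (∫ q, G q * fderiv ℝ Ψ q (1, 0)
        ∂((volume.restrict (Ioo (0 : ℝ) T)).prod (volume : Measure (Eu d × Eu d))))
        - ∫ p : Eu d × Eu d, G (0, p) * Ψ (0, p) := by
  have : (volume : Measure (Eu d × Eu d)).IsAddHaarMeasure :=
    inferInstanceAs ((volume : Measure (Eu d)).prod (volume : Measure (Eu d))).IsAddHaarMeasure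
  have h := (hG.mul_temperate hΨ).integral_fderiv_time volume hT (by simp [hΨ_T])
  have e : ∀ q, fderiv ℝ (fun q => G q * Ψ q) q (1, 0)
      = fderiv ℝ G q (1, 0) * Ψ q + G q * fderiv ℝ Ψ q (1, 0) := fun q => by
    rw [fderiv_fun_mul (hG.differentiable q) (hΨ.1.differentiable (by simp) q)]
    simp; ring
  simp_rw [e] at h
  rw [integral_add (((hG.fderiv_apply_const _).mul_temperate hΨ).integrable_prod volume)
    ((hG.mul_temperate (hΨ.fderiv_apply_const _)).integrable_prod volume)] at h
  linarith

/-- The velocity flux `∂_{v_i} F + v_i F` of the Fokker–Planck operator. -/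
def fpFlux (F : ℝ × Eu d × Eu d → ℝ) (i : Fin d) (q : ℝ × Eu d × Eu d) : ℝ :=
  fderiv ℝ F q (0, vDir i) + F q * vCoord i q

lemma RapidDecay.fpFlux {T : ℝ} {F : ℝ × Eu d × Eu d → ℝ} (hF : RapidDecay T F) (i : Fin d) :
    RapidDecay T (fpFlux F i) :=
  (hF.fderiv_apply_const _).add (hF.mul_temperate (vCoord i).hasTemperateGrowth)

/-- The Vlasov–Fokker–Planck equation in coordinates. -/
lemma vlasovFokkerPlanck_coord {T ε : ℝ} {f : ℝ → Eu d → Eu d → ℝ}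
    (hF : RapidDecay T (fun q : ℝ × Eu d × Eu d => f q.1 q.2.1 q.2.2)) {t : ℝ} {x v : Eu d}
    (hpde : ε * deriv (fun s => f s x v) t + fderiv ℝ (fun y => f t y v) x v
        = ε⁻¹ * divE (fun w => gradient (fun u => f t x u) w + f t x w • w) v) :
    ε * fderiv ℝ (fun q : ℝ × Eu d × Eu d => f q.1 q.2.1 q.2.2) (t, x, v) (1, 0)
      + ∑ i, v i * fderiv ℝ (fun q : ℝ × Eu d × Eu d => f q.1 q.2.1 q.2.2) (t, x, v) (0, xDir i)
      = ε⁻¹ * ∑ i, fderiv ℝ (fpFlux (fun q : ℝ × Eu d × Eu d => f q.1 q.2.1 q.2.2) i) (t, x, v)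
          (0, vDir i) := by
  set F : ℝ × Eu d × Eu d → ℝ := fun q => f q.1 q.2.1 q.2.2 with hF_def
  have ht : deriv (fun s => f s x v) t = fderiv ℝ F (t, x, v) (1, 0) := by
    have hc : HasDerivAt (fun s : ℝ => (s, x, v)) (1, 0) t :=
      (hasDerivAt_id t).prodMk (hasDerivAt_const t (x, v))
    exact ((hF.differentiable (t, x, v)).hasFDerivAt.comp_hasDerivAt t hc).deriv
  have hv : ∀ (G : ℝ × Eu d × Eu d → ℝ), Differentiable ℝ G → ∀ u w,
      fderiv ℝ (fun w => G (t, x, w)) u w = fderiv ℝ G (t, x, u) (0, 0, w) := by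
    intro G hG u w
    have hc : HasFDerivAt (fun w => (t, x, w))
        ((0 : Eu d →L[ℝ] ℝ).prod (ContinuousLinearMap.inr ℝ (Eu d) (Eu d))) u :=
      (hasFDerivAt_const t u).prodMk (hasFDerivAt_prodMk_right x u)
    have := (hG (t, x, u)).hasFDerivAt.comp u hc
    rw [show (fun w => G (t, x, w)) = G ∘ fun w => (t, x, w) from rfl, this.fderiv]
    simp
  have hx : fderiv ℝ (fun y => f t y v) x v
      = ∑ i, v i * fderiv ℝ F (t, x, v) (0, xDir i) := by
    have hc : HasFDerivAt (fun y => (t, y, v))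
        ((0 : Eu d →L[ℝ] ℝ).prod (ContinuousLinearMap.inl ℝ (Eu d) (Eu d))) x :=
      (hasFDerivAt_const t x).prodMk (hasFDerivAt_prodMk_left x v)
    have := (hF.differentiable (t, x, v)).hasFDerivAt.comp x hc
    rw [show (fun y => f t y v) = F ∘ fun y => (t, y, v) from rfl, this.fderiv]
    have e : ((0 : ℝ), v, (0 : Eu d)) = ∑ i, v i • ((0 : ℝ), xDir i) := by
      simp [xDir, Prod.ext_iff, Prod.fst_sum, Prod.snd_sum, sum_smul_basisE]
    calc _ = fderiv ℝ F (t, x, v) (0, v, 0) := by simp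
      _ = _ := by
        rw [e, map_sum]
        exact Finset.sum_congr rfl fun i _ => by rw [map_smul, smul_eq_mul]
  rw [ht, hx] at hpde
  rw [hpde, divE]
  congr 1
  refine Finset.sum_congr rfl fun i _ => ?_
  have e : (fun w => (gradient (fun u => f t x u) w + f t x w • w) i)
      = fun w => fpFlux F i (t, x, w) := by
    funext w
    have h1 : gradient (fun u => f t x u) w i = fderiv ℝ F (t, x, w) (0, vDir i) := by
      rw [← inner_basisE, gradient, InnerProductSpace.toDual_symm_apply]
      exact hv F hF.differentiable w _
    simp [fpFlux, h1, hF_def]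
  rw [e]
  exact hv _ (hF.fpFlux i).differentiable v _

/-- The weak formulation of the scaled Vlasov–Fokker–Planck equation. -/
lemma weak_vlasovFokkerPlanck {T ε : ℝ} (hT : 0 ≤ T) {F Ψ : ℝ × Eu d × Eu d → ℝ}
    (hF : RapidDecay T F) (hΨ : Function.HasTemperateGrowth Ψ) (hΨ_T : ∀ p, Ψ (T, p) = 0)
    (hpde : ∀ t ∈ Ioo (0 : ℝ) T, ∀ p, ε * fderiv ℝ F (t, p) (1, 0)
      + ∑ i, p.2 i * fderiv ℝ F (t, p) (0, xDir i)
      = ε⁻¹ * ∑ i, fderiv ℝ (fpFlux F i) (t, p) (0, vDir i))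
    (ν : Measure (ℝ × Eu d × Eu d)) (hν : ν = (volume.restrict (Ioo (0 : ℝ) T)).prod volume) :
    ε * ((∫ q, F q * fderiv ℝ Ψ q (1, 0) ∂ν) + ∫ p : Eu d × Eu d, F (0, p) * Ψ (0, p))
      + ∑ i, ∫ q, F q * (vCoord i q * fderiv ℝ Ψ q (0, xDir i)) ∂ν
      + ε⁻¹ * ∑ i, ((∫ q, F q * fderiv ℝ (fun z => fderiv ℝ Ψ z (0, vDir i)) q (0, vDir i) ∂ν)
        - ∫ q, F q * (vCoord i q * fderiv ℝ Ψ q (0, vDir i)) ∂ν) = 0 := by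
  have : (volume : Measure (Eu d × Eu d)).IsAddHaarMeasure :=
    inferInstanceAs ((volume : Measure (Eu d)).prod (volume : Measure (Eu d))).IsAddHaarMeasure
  have htime := hF.integral_fderiv_time_mul_temperate hT hΨ hΨ_T
  have hspace : ∀ i, ∫ q, fderiv ℝ F q (0, xDir i) * (vCoord i q * Ψ q) ∂ν
      = - ∫ q, F q * (vCoord i q * fderiv ℝ Ψ q (0, xDir i)) ∂ν := by
    intro i
    have h := hF.integral_fderiv_mul_temperate ((vCoord i).hasTemperateGrowth.fun_mul hΨ) (xDir i)
    rw [← hν] at h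
    rw [h]
    congr 2 with q
    rw [fderiv_fun_mul (vCoord i).differentiableAt (hΨ.1.differentiable (by simp) q)]
    simp [xDir]
  have hvel : ∀ i, ∫ q, fderiv ℝ (fpFlux F i) q (0, vDir i) * Ψ q ∂ν
      = (∫ q, F q * fderiv ℝ (fun z => fderiv ℝ Ψ z (0, vDir i)) q (0, vDir i) ∂ν)
        - ∫ q, F q * (vCoord i q * fderiv ℝ Ψ q (0, vDir i)) ∂ν := by
    intro i
    have hD := hΨ.fderiv_apply_const ((0 : ℝ), vDir i)
    have h1 := (hF.fpFlux i).integral_fderiv_mul_temperate hΨ (vDir i)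
    have h2 := hF.integral_fderiv_mul_temperate hD (vDir i)
    have i1 := ((hF.fderiv_apply_const (0, vDir i)).mul_temperate hD).integrable_prod volume
    have i2 := (hF.mul_temperate ((vCoord i).hasTemperateGrowth.fun_mul hD)).integrable_prod volume
    rw [← hν] at h1 h2 i1 i2
    rw [h1]
    have e : ∀ q, fpFlux F i q * fderiv ℝ Ψ q (0, vDir i)
        = fderiv ℝ F q (0, vDir i) * fderiv ℝ Ψ q (0, vDir i)
          + F q * (vCoord i q * fderiv ℝ Ψ q (0, vDir i)) := fun q => by rw [fpFlux]; ring
    simp_rw [e]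
    rw [integral_add i1 i2]
    linarith
  have it := ((hF.fderiv_apply_const (1, 0)).mul_temperate hΨ).integrable_prod volume
  have ix := fun i => ((hF.fderiv_apply_const (0, xDir i)).mul_temperate
    ((vCoord i).hasTemperateGrowth.fun_mul hΨ)).integrable_prod volume
  have iv := fun i => (((hF.fpFlux i).fderiv_apply_const (0, vDir i)).mul_temperate
    hΨ).integrable_prod volume
  rw [← hν] at htime it
  simp_rw [← hν] at ix iv
  have hmain : ε * (∫ q, fderiv ℝ F q (1, 0) * Ψ q ∂ν)
      + ∑ i, ∫ q, fderiv ℝ F q (0, xDir i) * (vCoord i q * Ψ q) ∂ν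
      = ε⁻¹ * ∑ i, ∫ q, fderiv ℝ (fpFlux F i) q (0, vDir i) * Ψ q ∂ν := by
    rw [← integral_const_mul, ← integral_finsetSum _ fun i _ => ix i,
      ← integral_finsetSum _ fun i _ => iv i, ← integral_const_mul,
      ← integral_add (it.const_mul ε) (integrable_finsetSum _ fun i _ => ix i)]
    refine integral_congr_ae ?_
    rw [hν, ← Measure.restrict_univ (μ := (volume : Measure (Eu d × Eu d))),
      Measure.prod_restrict]
    filter_upwards [ae_restrict_mem (measurableSet_Ioo.prod MeasurableSet.univ)] with q hq
    have h := congrArg (· * Ψ q) (hpde q.1 hq.1 q.2)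
    simp only [Prod.mk.eta, add_mul, Finset.sum_mul, mul_assoc] at h
    rw [← h]
    congr 1
    refine Finset.sum_congr rfl fun i _ => ?_
    simp only [vCoord_apply]
    ring
  rw [htime] at hmain
  simp_rw [hspace, hvel] at hmain
  rw [Finset.sum_neg_distrib] at hmain
  linarith

end WeakFormulation

section MomentIdentity

variable {d : ℕ}

/-- The projection `(t, x, v) ↦ (t, x)`. -/
def posProj (d : ℕ) : ℝ × Eu d × Eu d →L[ℝ] ℝ × Eu d :=
  (ContinuousLinearMap.fst ℝ ℝ (Eu d × Eu d)).prod
    ((ContinuousLinearMap.fst ℝ (Eu d) (Eu d)).comp (ContinuousLinearMap.snd ℝ ℝ (Eu d × Eu d)))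

lemma posProj_apply (q : ℝ × Eu d × Eu d) : posProj d q = (q.1, q.2.1) := rfl

lemma fderiv_comp_posProj {c : ℝ × Eu d → ℝ} (hc : Differentiable ℝ c) (q w : ℝ × Eu d × Eu d) :
    fderiv ℝ (fun z => c (posProj d z)) q w = fderiv ℝ c (posProj d q) (posProj d w) := by
  have := (hc (posProj d q)).hasFDerivAt.comp q (posProj d).hasFDerivAt
  rw [show (fun z => c (posProj d z)) = c ∘ posProj d from rfl, this.fderiv]
  rfl

lemma hasTemperateGrowth_comp_posProj {c : ℝ × Eu d → ℝ} (hc : ContDiff ℝ (⊤ : ℕ∞) c)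
    (hcs : HasCompactSupport c) : Function.HasTemperateGrowth (fun z => c (posProj d z)) :=
  (hcs.hasTemperateGrowth hc).comp (posProj d).hasTemperateGrowth

lemma hasCompactSupport_fderiv_apply {X : Type*} [NormedAddCommGroup X] [NormedSpace ℝ X]
    {c : X → ℝ} (hc : HasCompactSupport c) (w : X) :
    HasCompactSupport (fun q => fderiv ℝ c q w) :=
  (hc.fderiv ℝ).comp_left (g := fun L : X →L[ℝ] ℝ => L w) (by simp)

lemma basisE_apply (i j : Fin d) : basisE d i j = if j = i then 1 else 0 := by
  simp [basisE]

/-- Testing the equation against `φ + ε v · ∇ₓ φ`. -/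
lemma moment_identity {T ε : ℝ} (hT : 0 ≤ T) (hε : ε ≠ 0) {F : ℝ × Eu d × Eu d → ℝ}
    (hF : RapidDecay T F)
    (hpde : ∀ t ∈ Ioo (0 : ℝ) T, ∀ p, ε * fderiv ℝ F (t, p) (1, 0)
      + ∑ i, p.2 i * fderiv ℝ F (t, p) (0, xDir i)
      = ε⁻¹ * ∑ i, fderiv ℝ (fpFlux F i) (t, p) (0, vDir i))
    (ν : Measure (ℝ × Eu d × Eu d)) (hν : ν = (volume.restrict (Ioo (0 : ℝ) T)).prod volume)
    {φ : ℝ × Eu d → ℝ} (hφ : ContDiff ℝ (⊤ : ℕ∞) φ) (hφc : HasCompactSupport φ)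
    (hφT : ∀ x, φ (T, x) = 0) (hφT' : ∀ x w, fderiv ℝ φ (T, x) w = 0) :
    (∫ q, F q * fderiv ℝ φ (posProj d q) (1, 0) ∂ν)
      + (∫ p : Eu d × Eu d, F (0, p) * φ (0, p.1))
      + ∑ j, ∑ i, ∫ q, F q * (q.2.2 i * q.2.2 j *
          fderiv ℝ (fun z => fderiv ℝ φ z (0, basisE d j)) (posProj d q) (0, basisE d i)) ∂ν
      + ε * ∑ j, ((∫ q, F q * (q.2.2 j *
          fderiv ℝ (fun z => fderiv ℝ φ z (0, basisE d j)) (posProj d q) (1, 0)) ∂ν)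
        + ∫ p : Eu d × Eu d, F (0, p) * (p.2 j * fderiv ℝ φ (0, p.1) (0, basisE d j))) = 0 := by
  have hφd := hφ.differentiable (by simp)
  have pt : posProj d (1, 0) = (1, 0) := rfl
  have px : ∀ i : Fin d, posProj d (0, xDir i) = (0, basisE d i) := fun i => rfl
  have pv : ∀ i : Fin d, posProj d (0, vDir i) = 0 := fun i => rfl
  have h0 := weak_vlasovFokkerPlanck hT hF (hasTemperateGrowth_comp_posProj hφ hφc)
    (fun p => hφT _) hpde ν hν
  simp only [fderiv_comp_posProj hφd, pt, px, pv, map_zero, fderiv_fun_const, Pi.zero_apply,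
    _root_.zero_apply, mul_zero, integral_zero, sub_zero, Finset.sum_const_zero,
    add_zero] at h0
  have h1 : ∀ j, ε * ((∫ q, F q * (q.2.2 j *
          fderiv ℝ (fun z => fderiv ℝ φ z (0, basisE d j)) (posProj d q) (1, 0)) ∂ν)
        + ∫ p : Eu d × Eu d, F (0, p) * (p.2 j * fderiv ℝ φ (0, p.1) (0, basisE d j)))
      + (∑ i, ∫ q, F q * (q.2.2 i * q.2.2 j *
          fderiv ℝ (fun z => fderiv ℝ φ z (0, basisE d j)) (posProj d q) (0, basisE d i)) ∂ν)
      - ε⁻¹ * ∫ q, F q * (q.2.2 j * fderiv ℝ φ (posProj d q) (0, basisE d j)) ∂ν = 0 := by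
    intro j
    have hψ := contDiff_fderiv_apply_const hφ ((0 : ℝ), basisE d j)
    have hψd : Differentiable ℝ fun z => fderiv ℝ φ z (0, basisE d j) :=
      hψ.differentiable (by simp)
    have hψt := hasTemperateGrowth_comp_posProj hψ
      (hasCompactSupport_fderiv_apply hφc ((0 : ℝ), basisE d j))
    have hΨ := (vCoord j).hasTemperateGrowth.fun_mul hψt
    have hfd : ∀ q w, fderiv ℝ (fun z => vCoord j z *
          fderiv ℝ φ (posProj d z) (0, basisE d j)) q w
        = vCoord j q * fderiv ℝ (fun z => fderiv ℝ φ z (0, basisE d j)) (posProj d q)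
            (posProj d w) + vCoord j w * fderiv ℝ φ (posProj d q) (0, basisE d j) := by
      intro q w
      rw [fderiv_fun_mul (vCoord j).differentiableAt (hψt.1.differentiable (by simp) q)]
      simp [fderiv_comp_posProj hψd, mul_comm]
    have h := weak_vlasovFokkerPlanck hT hF hΨ
      (fun p => by rw [posProj_apply]; simp [hφT']) hpde ν hν
    have vt : vCoord j ((1 : ℝ), (0 : Eu d × Eu d)) = 0 := rfl
    have vx : ∀ i, vCoord j ((0 : ℝ), xDir i) = 0 := fun i => rfl
    have vv : ∀ i, vCoord j ((0 : ℝ), vDir i) = if j = i then 1 else 0 := fun i =>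
      basisE_apply i j
    have hvv : ∀ i q, fderiv ℝ (fun z => (if j = i then (1 : ℝ) else 0) *
        fderiv ℝ φ (posProj d z) (0, basisE d j)) q (0, vDir i) = 0 := by
      intro i q
      split_ifs <;> simp [fderiv_comp_posProj hψd, pv]
    simp only [hfd, pt, px, pv, map_zero, vt, vx, vv, hvv, mul_zero, zero_mul, add_zero, zero_add,
      integral_zero, zero_sub] at h
    have hsum : ∑ i, -∫ q, F q * (vCoord i q * ((if j = i then (1 : ℝ) else 0) *
        fderiv ℝ φ (posProj d q) (0, basisE d j))) ∂ν
        = - ∫ q, F q * (q.2.2 j * fderiv ℝ φ (posProj d q) (0, basisE d j)) ∂ν := by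
      rw [Finset.sum_eq_single j (fun i _ hi => by simp [hi.symm]) (by simp)]
      simp
    rw [hsum] at h
    simp only [vCoord_apply, posProj_apply] at h ⊢
    simp only [← mul_assoc] at h ⊢
    linarith
  have h2 := Finset.sum_congr (rfl : (Finset.univ : Finset (Fin d)) = _) fun j _ => h1 j
  rw [Finset.sum_const_zero, Finset.sum_sub_distrib, Finset.sum_add_distrib, ← Finset.mul_sum,
    ← Finset.mul_sum] at h2
  simp only [posProj_apply, vCoord_apply] at h0 h2 ⊢
  have h3 := congrArg (ε⁻¹ * ·) h0
  simp only [mul_zero, mul_add, inv_mul_cancel_left₀ hε] at h3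
  linarith

end MomentIdentity

section GaussianMoments

variable {d : ℕ}

lemma gaussM_pos (v : Eu d) : 0 < gaussM d v := by
  unfold gaussM; positivity

lemma contDiff_gaussM : ContDiff ℝ (⊤ : ℕ∞) (gaussM d) := by
  unfold gaussM
  exact contDiff_const.mul ((contDiff_norm_sq ℝ).neg.div_const 2).exp

lemma fderiv_gaussM (v w : Eu d) : fderiv ℝ (gaussM d) v w = - inner ℝ v w * gaussM d v := by
  have h : HasFDerivAt (gaussM d) _ v :=
    (((hasStrictFDerivAt_norm_sq v).hasFDerivAt.neg.mul_const (1 / 2)).exp).const_mul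
      ((2 * π) ^ (-(d : ℝ) / 2)) |>.congr_of_eventuallyEq (.of_forall fun u => by
        simp [gaussM, div_eq_mul_inv])
  rw [h.fderiv]
  simp [gaussM, div_eq_mul_inv]
  ring

lemma exists_norm_pow_mul_gaussM_le (k : ℕ) : ∃ C, ∀ v : Eu d, ‖v‖ ^ k * gaussM d v ≤ C := by
  set c : ℝ := (2 * π) ^ (-(d : ℝ) / 2)
  have hc : 0 ≤ c := by positivity
  refine ⟨c * (1 + 2 ^ k * k.factorial), fun v => ?_⟩
  have h1 : ‖v‖ ^ k ≤ 1 + ‖v‖ ^ (2 * k) := by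
    rcases le_total ‖v‖ 1 with h | h
    · exact (pow_le_one₀ (norm_nonneg v) h).trans (by simp)
    · exact (pow_le_pow_right₀ h (Nat.le_mul_of_pos_left k two_pos)).trans (by simp)
  have h2 := Real.pow_div_factorial_le_exp (‖v‖ ^ 2 / 2) (by positivity) k
  rw [div_le_iff₀ (by positivity), div_pow, div_le_iff₀ (by positivity), ← pow_mul] at h2
  have h3 : rexp (-‖v‖ ^ 2 / 2) * rexp (‖v‖ ^ 2 / 2) = 1 := by
    rw [← Real.exp_add]; simp [neg_div]
  have h4 : rexp (-‖v‖ ^ 2 / 2) ≤ 1 := by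
    rw [Real.exp_le_one_iff]; have := sq_nonneg ‖v‖; linarith
  calc ‖v‖ ^ k * gaussM d v = c * (‖v‖ ^ k * rexp (-‖v‖ ^ 2 / 2)) := by rw [gaussM]; ring
    _ ≤ c * ((1 + ‖v‖ ^ (2 * k)) * rexp (-‖v‖ ^ 2 / 2)) := by gcongr
    _ ≤ c * ((1 + rexp (‖v‖ ^ 2 / 2) * k.factorial * 2 ^ k) * rexp (-‖v‖ ^ 2 / 2)) := by gcongr
    _ = c * (rexp (-‖v‖ ^ 2 / 2) + 2 ^ k * k.factorial *
        (rexp (-‖v‖ ^ 2 / 2) * rexp (‖v‖ ^ 2 / 2))) := by ring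
    _ ≤ _ := by rw [h3, mul_one]; gcongr

lemma integrable_gaussM_mul {m : Eu d → ℝ} (hm : Continuous m) {k : ℕ} {C : ℝ}
    (hC : ∀ v, |m v| ≤ C * ‖v‖ ^ k) : Integrable (fun v => gaussM d v * m v) := by
  obtain ⟨A, hA⟩ := exists_norm_pow_mul_gaussM_le (d := d) 0
  obtain ⟨B, hB⟩ := exists_norm_pow_mul_gaussM_le (d := d)
    (k + (volume : Measure (Eu d)).integrablePower)
  have hn : ∀ v : Eu d, ‖gaussM d v‖ = gaussM d v := fun v => by
    rw [Real.norm_eq_abs, abs_of_pos (gaussM_pos v)]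
  have h := integrable_of_le_of_pow_mul_le (μ := (volume : Measure (Eu d))) (f := gaussM d)
    (C₁ := A) (C₂ := B) (k := k) (fun v => by simpa [hn] using hA v)
    (fun v => by simpa [hn] using hB v) contDiff_gaussM.continuous.aestronglyMeasurable
  refine (h.const_mul C).mono' (contDiff_gaussM.continuous.mul hm).aestronglyMeasurable
    (ae_of_all _ fun v => ?_)
  rw [norm_mul, hn, Real.norm_eq_abs]
  calc gaussM d v * |m v| ≤ gaussM d v * (C * ‖v‖ ^ k) := by gcongr; exacts [(gaussM_pos v).le, hC v]
    _ = _ := by ring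

lemma integral_gaussM : ∫ v, gaussM d v = 1 := by
  have h := GaussianFourier.integral_rexp_neg_mul_sq_norm (V := Eu d) (b := 1 / 2) (by norm_num)
  simp only [gaussM]
  rw [integral_const_mul]
  have e : ∀ v : Eu d, rexp (-‖v‖ ^ 2 / 2) = rexp (-(1 / 2) * ‖v‖ ^ 2) := fun v => by
    congr 1; ring
  simp_rw [e]
  rw [h, finrank_euclideanSpace_fin, show π / (1 / 2) = 2 * π by ring,
    ← Real.rpow_add (by positivity)]
  simp [neg_div]

lemma abs_coord_le (v : Eu d) (i : Fin d) : |v i| ≤ ‖v‖ := by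
  simpa using EuclideanSpace.norm_eq v ▸ PiLp.norm_apply_le v i

lemma continuous_coord (i : Fin d) : Continuous fun v : Eu d => v i :=
  (EuclideanSpace.proj (𝕜 := ℝ) i).continuous

lemma integral_gaussM_mul_coord_mul_coord (i j : Fin d) :
    ∫ v : Eu d, gaussM d v * (v i * v j) = if j = i then 1 else 0 := by
  have hi : Integrable fun v : Eu d => gaussM d v := by
    simpa using integrable_gaussM_mul (d := d) (m := fun _ => 1) continuous_const (k := 0) (C := 1)
      (by simp)
  have hj : ∀ v : Eu d, fderiv ℝ (fun v : Eu d => v j) v (basisE d i) = if j = i then 1 else 0 :=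
    fun v => by
      rw [show (fun v : Eu d => v j) = EuclideanSpace.proj (𝕜 := ℝ) j from rfl,
        ContinuousLinearMap.fderiv]
      exact basisE_apply i j
  have hM : ∀ v : Eu d, fderiv ℝ (gaussM d) v (basisE d i) * v j = -(gaussM d v * (v i * v j)) :=
    fun v => by rw [fderiv_gaussM, inner_basisE]; ring
  have h := integral_mul_fderiv_eq_neg_fderiv_mul_of_integrable (μ := (volume : Measure (Eu d)))
    (f := gaussM d) (g := fun v : Eu d => v j) (v := basisE d i)
    (by
      simp_rw [hM]
      refine (integrable_gaussM_mul ((continuous_coord i).mul (continuous_coord j)) (k := 2)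
        (C := 1) fun v => ?_).neg
      rw [Pi.mul_apply, abs_mul, one_mul, sq]
      exact mul_le_mul (abs_coord_le v i) (abs_coord_le v j) (abs_nonneg _) (norm_nonneg _))
    (by simp_rw [hj]; exact hi.mul_const _)
    (integrable_gaussM_mul (continuous_coord j) (k := 1) (C := 1) fun v => by
      simpa using abs_coord_le v j)
    (fun v _ => contDiff_gaussM.differentiable (by simp) v)
    (fun v _ => (EuclideanSpace.proj (𝕜 := ℝ) j).differentiableAt)
  simp_rw [hj, hM] at h
  rw [integral_neg, neg_neg, integral_mul_const, integral_gaussM, one_mul] at h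
  exact h.symm

end GaussianMoments

section Limit

variable {d : ℕ}

lemma restrict_Ioo_prod_volume (T : ℝ) (P : Type*) [MeasureSpace P]
    [SFinite (volume : Measure P)] :
    (volume.restrict (Ioo (0 : ℝ) T)).prod (volume : Measure P)
      = (volume : Measure (ℝ × P)).restrict (Ioo 0 T ×ˢ univ) := by
  conv_lhs => rw [← Measure.restrict_univ (μ := (volume : Measure P)), Measure.prod_restrict]
  rfl

lemma integrable_mul_of_sq_integrableOn {T : ℝ} {ρ : ℝ → Eu d → ℝ}
    (hρmeas : Measurable fun p : ℝ × Eu d => ρ p.1 p.2)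
    (hρL2 : IntegrableOn (fun p : ℝ × Eu d => (ρ p.1 p.2) ^ 2) (Ioo 0 T ×ˢ univ))
    {c : ℝ × Eu d → ℝ} (hc : Continuous c) (hcs : HasCompactSupport c) :
    Integrable (fun z => ρ z.1 z.2 * c z)
      ((volume.restrict (Ioo (0 : ℝ) T)).prod (volume : Measure (Eu d))) := by
  rw [restrict_Ioo_prod_volume]
  have h1 : MemLp (fun z : ℝ × Eu d => ρ z.1 z.2) 2 (volume.restrict (Ioo 0 T ×ˢ univ)) :=
    (memLp_two_iff_integrable_sq hρmeas.aestronglyMeasurable).2 hρL2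
  have h2 : MemLp c 2 (volume.restrict (Ioo (0 : ℝ) T ×ˢ (univ : Set (Eu d)))) :=
    (hc.memLp_of_hasCompactSupport hcs).restrict _
  exact h1.integrable_mul h2

lemma integrable_mul_prodAssoc {A B C : Type*} [MeasureSpace A] [MeasureSpace B]
    [MeasureSpace C] [SFinite (volume : Measure A)] [SFinite (volume : Measure B)]
    [SFinite (volume : Measure C)] {h : A × B → ℝ} {k : C → ℝ} (hh : Integrable h)
    (hk : Integrable k) : Integrable fun p : A × B × C => h (p.1, p.2.1) * k p.2.2 := by
  have hp := measurePreserving_prodAssoc (volume : Measure A) (volume : Measure B)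
    (volume : Measure C)
  exact (hp.integrable_comp_emb MeasurableEquiv.prodAssoc.measurableEmbedding).1 (hh.mul_prod hk)

/-- Weak convergence tested against `M(v) m(v) c(t, x)`. -/
lemma tendsto_moment {T : ℝ} {f : ℝ → ℝ → Eu d → Eu d → ℝ}
    (hF : ∀ ε > (0 : ℝ), RapidDecay T (fun q : ℝ × Eu d × Eu d => f ε q.1 q.2.1 q.2.2))
    {ρ : ℝ → Eu d → ℝ} (hρmeas : Measurable fun p : ℝ × Eu d => ρ p.1 p.2)
    (hρL2 : IntegrableOn (fun p : ℝ × Eu d => (ρ p.1 p.2) ^ 2) (Ioo 0 T ×ˢ univ))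
    (hweak : ∀ g : ℝ → Eu d → Eu d → ℝ,
      Measurable (fun p : ℝ × Eu d × Eu d => g p.1 p.2.1 p.2.2) →
      IntegrableOn (fun p : ℝ × Eu d × Eu d => (g p.1 p.2.1 p.2.2) ^ 2 / gaussM d p.2.2)
        (Ioo 0 T ×ˢ univ) →
      Tendsto (fun ε => ∫ t in Ioo (0 : ℝ) T, ∫ x : Eu d, ∫ v : Eu d,
          f ε t x v * g t x v / gaussM d v)
        (𝓝[>] 0)
        (𝓝 (∫ t in Ioo (0 : ℝ) T, ∫ x : Eu d, ∫ v : Eu d, ρ t x * g t x v)))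
    {m : Eu d → ℝ} (hm : Function.HasTemperateGrowth m) {k : ℕ} (hmk : ∀ v, |m v| ≤ ‖v‖ ^ k)
    {c : ℝ × Eu d → ℝ} (hc : ContDiff ℝ (⊤ : ℕ∞) c) (hcs : HasCompactSupport c) :
    Tendsto (fun ε => ∫ q : ℝ × Eu d × Eu d, f ε q.1 q.2.1 q.2.2 * (m q.2.2 * c (posProj d q))
        ∂((volume.restrict (Ioo (0 : ℝ) T)).prod volume)) (𝓝[>] 0)
      (𝓝 ((∫ v, gaussM d v * m v) * ∫ z : ℝ × Eu d, ρ z.1 z.2 * c z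
        ∂((volume.restrict (Ioo (0 : ℝ) T)).prod volume))) := by
  have : (volume : Measure (Eu d × Eu d)).IsAddHaarMeasure :=
    inferInstanceAs ((volume : Measure (Eu d)).prod (volume : Measure (Eu d))).IsAddHaarMeasure
  have hmc := hm.1.continuous
  have hg := hweak (fun t x v => gaussM d v * (m v * c (t, x))) ?_ ?_
  · convert hg.congr' ?_ using 2
    · rw [integral_prod _ (integrable_mul_of_sq_integrableOn hρmeas hρL2 hc.continuous hcs),
        ← integral_const_mul]
      congr 1 with t
      rw [← integral_const_mul]
      congr 1 with x
      rw [← integral_mul_const]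
      congr 1 with v
      ring
    · filter_upwards [self_mem_nhdsWithin] with ε hε
      have hR := (hF ε hε).mul_temperate ((hm.comp ((ContinuousLinearMap.snd ℝ (Eu d) (Eu d)).comp
        (ContinuousLinearMap.snd ℝ ℝ (Eu d × Eu d))).hasTemperateGrowth).fun_mul
        (hasTemperateGrowth_comp_posProj hc hcs))
      have h1 := integral_prod _ (hR.integrable_prod volume)
      simp only [Function.comp_def, ContinuousLinearMap.comp_apply,
        ContinuousLinearMap.coe_snd'] at h1
      rw [h1]
      refine setIntegral_congr_fun measurableSet_Ioo fun t ht => ?_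
      have h2 := integral_prod _ (hR.integrable_slice volume ⟨ht.1.le, ht.2.le⟩)
      simp only [Function.comp_def, ContinuousLinearMap.comp_apply,
        ContinuousLinearMap.coe_snd'] at h2
      refine Eq.trans ?_ h2.symm
      congr 1 with x
      congr 1 with v
      have := (gaussM_pos v).ne'
      simp only [posProj_apply]
      field_simp
  · refine Continuous.measurable ?_
    exact (contDiff_gaussM.continuous.comp (by fun_prop)).mul
      ((hmc.comp (by fun_prop)).mul (hc.continuous.comp (by fun_prop)))
  · have i1 : Integrable (fun z => c z ^ 2) :=
      (hc.continuous.memLp_of_hasCompactSupport (p := 2) hcs).integrable_sq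
    have i2 : Integrable (fun v => gaussM d v * m v ^ 2) :=
      integrable_gaussM_mul (hmc.pow 2) (k := k * 2) (C := 1) fun v => by
        rw [one_mul, abs_pow, pow_mul]
        exact pow_le_pow_left₀ (abs_nonneg _) (hmk v) 2
    refine ((integrable_mul_prodAssoc i1 i2).congr (ae_of_all _ fun p => ?_)).integrableOn
    have := (gaussM_pos p.2.2).ne'
    field_simp

end Limit

/-- diffusion limit of the scaled Vlasov–Fokker–Planck equation in the
whole space: if `f^ε ⇀ ρ M` weakly in `L²(M⁻¹)`, then `ρ` solves the heat equation
`∂_t ρ − Δ_x ρ = 0` in the distributional sense with initial datum `ρ_in = ∫ f_in dv`. -/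
theorem statement10 (d : ℕ) (hd : 1 ≤ d) (T : ℝ) (hT : 0 < T)
    (f_in : Eu d → Eu d → ℝ)
    (hfin_nonneg : ∀ x v : Eu d, 0 ≤ f_in x v)
    (hfin_L2 : Integrable (fun p : Eu d × Eu d => (f_in p.1 p.2) ^ 2 / gaussM d p.2))
    (f : ℝ → ℝ → Eu d → Eu d → ℝ)
    (hsmooth : ∀ ε > (0 : ℝ),
      ContDiff ℝ (⊤ : ℕ∞) (fun p : ℝ × Eu d × Eu d => f ε p.1 p.2.1 p.2.2))
    (hschwartz : ∀ ε > (0 : ℝ), ∀ k m : ℕ, ∃ Ckm : ℝ,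
      ∀ t ∈ Icc (0 : ℝ) T, ∀ p : Eu d × Eu d,
        ‖p‖ ^ k * ‖iteratedFDeriv ℝ m
          (fun q : ℝ × Eu d × Eu d => f ε q.1 q.2.1 q.2.2) (t, p)‖ ≤ Ckm)
    (hpde : ∀ ε > (0 : ℝ), ∀ t ∈ Ioo (0 : ℝ) T, ∀ x v : Eu d,
      ε * deriv (fun s => f ε s x v) t + fderiv ℝ (fun y => f ε t y v) x v
        = ε⁻¹ * divE (fun w => gradient (fun u => f ε t x u) w + f ε t x w • w) v)
    (hinit : ∀ ε > (0 : ℝ), ∀ x v : Eu d, f ε 0 x v = f_in x v)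
    (hbound : ∃ C : ℝ, ∀ ε > (0 : ℝ), ∀ t ∈ Icc (0 : ℝ) T,
      (∫ x : Eu d, ∫ v : Eu d, (f ε t x v) ^ 2 / gaussM d v) ≤ C)
    (ρ : ℝ → Eu d → ℝ)
    (hρmeas : Measurable fun p : ℝ × Eu d => ρ p.1 p.2)
    (hρL2 : IntegrableOn (fun p : ℝ × Eu d => (ρ p.1 p.2) ^ 2) (Ioo 0 T ×ˢ univ))
    (hweak : ∀ g : ℝ → Eu d → Eu d → ℝ,
      Measurable (fun p : ℝ × Eu d × Eu d => g p.1 p.2.1 p.2.2) →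
      IntegrableOn (fun p : ℝ × Eu d × Eu d => (g p.1 p.2.1 p.2.2) ^ 2 / gaussM d p.2.2)
        (Ioo 0 T ×ˢ univ) →
      Tendsto (fun ε => ∫ t in Ioo (0 : ℝ) T, ∫ x : Eu d, ∫ v : Eu d,
          f ε t x v * g t x v / gaussM d v)
        (𝓝[>] 0)
        (𝓝 (∫ t in Ioo (0 : ℝ) T, ∫ x : Eu d, ∫ v : Eu d, ρ t x * g t x v))) :
    ∀ φ : ℝ × Eu d → ℝ, ContDiff ℝ (⊤ : ℕ∞) φ → HasCompactSupport φ →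
      tsupport φ ⊆ Iio T ×ˢ univ →
      (∫ t in Ioo (0 : ℝ) T, ∫ x : Eu d,
          ρ t x * (deriv (fun s => φ (s, x)) t + lapE (fun y => φ (t, y)) x))
        + (∫ x : Eu d, (∫ v : Eu d, f_in x v) * φ (0, x)) = 0 := by
  intro φ hφ hφc hφs
  have : (volume : Measure (Eu d × Eu d)).IsAddHaarMeasure :=
    inferInstanceAs ((volume : Measure (Eu d)).prod (volume : Measure (Eu d))).IsAddHaarMeasure
  have hF : ∀ ε > (0 : ℝ), RapidDecay T (fun q : ℝ × Eu d × Eu d => f ε q.1 q.2.1 q.2.2) :=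
    fun ε hε => ⟨hsmooth ε hε, hschwartz ε hε⟩
  have hφd := hφ.differentiable (by simp)
  have hT_notMem : ∀ x, (T, x) ∉ tsupport φ := fun x hx => lt_irrefl T (hφs hx).1
  have hφT : ∀ x, φ (T, x) = 0 := fun x => image_eq_zero_of_notMem_tsupport (hT_notMem x)
  have hφT' : ∀ x w, fderiv ℝ φ (T, x) w = 0 := fun x w => by
    rw [fderiv_of_notMem_tsupport ℝ (hT_notMem x), _root_.zero_apply]
  have hψ := fun w => contDiff_fderiv_apply_const hφ w
  have hψc := fun w => hasCompactSupport_fderiv_apply hφc w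
  have hψ' := fun w w' => contDiff_fderiv_apply_const (hψ w) w'
  have hψc' := fun w w' => hasCompactSupport_fderiv_apply (hψc w) w'
  have hcoord : ∀ i, Function.HasTemperateGrowth fun v : Eu d => v i := fun i =>
    (EuclideanSpace.proj (𝕜 := ℝ) i).hasTemperateGrowth
  have lim_time := tendsto_moment hF hρmeas hρL2 hweak (Function.HasTemperateGrowth.const 1)
    (k := 0) (by simp) (hψ (1, 0)) (hψc (1, 0))
  have lim_space := fun i j => tendsto_moment hF hρmeas hρL2 hweak
    ((hcoord i).fun_mul (hcoord j)) (k := 2)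
    (fun v => by
      rw [abs_mul, sq]
      exact mul_le_mul (abs_coord_le v i) (abs_coord_le v j) (abs_nonneg _) (norm_nonneg _))
    (hψ' (0, basisE d j) (0, basisE d i)) (hψc' (0, basisE d j) (0, basisE d i))
  have lim_flux := fun j => tendsto_moment hF hρmeas hρL2 hweak (hcoord j) (k := 1)
    (fun v => by simpa using abs_coord_le v j)
    (hψ' (0, basisE d j) (1, 0)) (hψc' (0, basisE d j) (1, 0))
  simp only [mul_one, one_mul, integral_gaussM] at lim_time
  simp only [integral_gaussM_mul_coord_mul_coord] at lim_space
  have lim_eps : Tendsto (fun ε : ℝ => ε) (𝓝[>] 0) (𝓝 0) := nhdsWithin_le_nhds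
  have lim := ((lim_time.add_const
    (∫ p : Eu d × Eu d, f_in p.1 p.2 * φ (0, p.1))).add
    (tendsto_finsetSum Finset.univ fun j _ =>
      tendsto_finsetSum Finset.univ fun i _ => lim_space i j)).add
    (lim_eps.mul (tendsto_finsetSum Finset.univ fun j _ => (lim_flux j).add_const
      (∫ p : Eu d × Eu d, f_in p.1 p.2 * (p.2 j * fderiv ℝ φ (0, p.1) (0, basisE d j)))))
  have hzero := tendsto_nhds_unique (lim.congr' (f₂ := fun _ => (0 : ℝ)) ?_) tendsto_const_nhds
  · have hdt : ∀ t x, deriv (fun s => φ (s, x)) t = fderiv ℝ φ (t, x) (1, 0) := fun t x => by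
      have hc : HasDerivAt (fun s : ℝ => (s, x)) (1, 0) t :=
        (hasDerivAt_id t).prodMk (hasDerivAt_const t x)
      exact ((hφd (t, x)).hasFDerivAt.comp_hasDerivAt t hc).deriv
    have hdx : ∀ (c : ℝ × Eu d → ℝ), Differentiable ℝ c → ∀ t x w,
        fderiv ℝ (fun y => c (t, y)) x w = fderiv ℝ c (t, x) (0, w) := fun c hc t x w => by
      have := (hc (t, x)).hasFDerivAt.comp x (hasFDerivAt_prodMk_right t x)
      rw [show (fun y => c (t, y)) = c ∘ fun y => (t, y) from rfl, this.fderiv]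
      simp
    have hlap : ∀ t x, lapE (fun y => φ (t, y)) x
        = ∑ i, fderiv ℝ (fun z => fderiv ℝ φ z (0, basisE d i)) (t, x) (0, basisE d i) :=
      fun t x => by
        simp only [lapE, hdx φ hφd]
        exact Finset.sum_congr rfl fun i _ =>
          hdx (fun z => fderiv ℝ φ z (0, basisE d i)) ((hψ _).differentiable (by simp)) t x _
    have it := integrable_mul_of_sq_integrableOn hρmeas hρL2 (hψ (1, 0)).continuous (hψc (1, 0))
    have ix := fun i => integrable_mul_of_sq_integrableOn hρmeas hρL2
      (hψ' (0, basisE d i) (0, basisE d i)).continuous (hψc' (0, basisE d i) (0, basisE d i))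
    have hheat := integral_prod _ (it.add (integrable_finsetSum Finset.univ fun i _ => ix i))
    simp only [Pi.add_apply, ← Finset.mul_sum, ← mul_add] at hheat
    simp only [hdt, hlap]
    rw [← hheat]
    simp only [mul_add, Finset.mul_sum]
    rw [integral_add it (integrable_finsetSum _ fun i _ => ix i),
      integral_finsetSum _ fun i _ => ix i]
    have hin : ∫ p : Eu d × Eu d, f_in p.1 p.2 * φ (0, p.1)
        = ∫ x : Eu d, (∫ v : Eu d, f_in x v) * φ (0, x) := by
      have h := ((hF 1 one_pos).mul_temperate
        (hasTemperateGrowth_comp_posProj hφ hφc)).integrable_slice volume ⟨le_rfl, hT.le⟩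
      simp only [posProj_apply, hinit 1 one_pos] at h
      refine (integral_prod _ h).trans ?_
      simp only [integral_mul_const]
    rw [← hin]
    simp only [zero_mul, add_zero, ite_mul, one_mul, Finset.sum_ite_eq, Finset.mem_univ,
      if_true] at hzero
    linarith
  · filter_upwards [self_mem_nhdsWithin] with ε hε
    have h := moment_identity hT.le (ne_of_gt hε) (hF ε hε)
      (fun t ht p => vlasovFokkerPlanck_coord (hF ε hε) (hpde ε hε t ht p.1 p.2)) _ rfl
      hφ hφc hφT hφT'
    simpa only [hinit ε hε] using h
end
end

section
/- Let d ≥ 1 and let ζ : ℝ^d → ℝ be twice continuously differentiable and strongly convex, i.e. there is C_ζ > 0 such that ⟨ξ, D²ζ(x) ξ⟩ ≥ C_ζ |ξ|² for all x, ξ ∈ ℝ^d. Let Ω := {x : ζ(x) < 0} be nonempty, let x₀ ∈ Ω and v ∈ ℝ^d with v ≠ 0, and set s₁ := inf{ℓ > 0 : x₀ + ℓ v ∉ Ω}. Then s₁ is finite and positive, ζ(x₀ + s₁ v) = 0 (the trajectory reaches the boundary), and v · ∇ζ(x₀ + s₁ v) > 0 (the trajectory hits the boundary non-tangentially, i.e.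 the exit point does not belong to the grazing set {(x,v) : x ∈ ∂Ω, v·n(x) = 0}). -/
open MeasureTheory Real Set Filter Topology
open scoped ENNReal RealInnerProductSpace

noncomputable section

/-- A function on the line with second derivative at least `c` lies above each of its tangent
parabolas with leading coefficient `c / 2`. -/
theorem tangent_parabola_le {f g g' : ℝ → ℝ} {c : ℝ} (hf : ∀ t, HasDerivAt f (g t) t)
    (hg : ∀ t, HasDerivAt g (g' t) t) (hc : ∀ t, c ≤ g' t) (s t : ℝ) :
    f s + g s * (t - s) + c / 2 * (t - s) ^ 2 ≤ f t := by
  have hmono : Monotone fun u => g u - c * u := by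
    have hd (u : ℝ) : HasDerivAt (fun u => g u - c * u) (g' u - c) u :=
      ((hg u).sub ((hasDerivAt_id u).const_mul c)).congr_deriv (by rw [mul_one])
    refine monotone_of_deriv_nonneg (fun u => (hd u).differentiableAt) fun u => ?_
    rw [(hd u).deriv]
    linarith [hc u]
  have hd (u : ℝ) : HasDerivAt (fun u => f u - c / 2 * u ^ 2) (g u - c * u) u := by
    refine ((hf u).sub ((hasDerivAt_pow 2 u).const_mul (c / 2))).congr_deriv ?_
    simp
    ring
  have hcont : Continuous fun u => f u - c / 2 * u ^ 2 :=
    continuous_iff_continuousAt.2 fun u => (hd u).continuousAt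
  rcases lt_trichotomy s t with h | rfl | h
  · obtain ⟨u, hu, he⟩ := exists_hasDerivAt_eq_slope _ _ h hcont.continuousOn fun u _ => hd u
    rw [eq_div_iff (sub_pos.2 h).ne'] at he
    nlinarith [mul_le_mul_of_nonneg_right (hmono hu.1.le) (sub_pos.2 h).le]
  · simp
  · obtain ⟨u, hu, he⟩ := exists_hasDerivAt_eq_slope _ _ h hcont.continuousOn fun u _ => hd u
    rw [eq_div_iff (sub_pos.2 h).ne'] at he
    nlinarith [mul_le_mul_of_nonneg_right (hmono hu.2.le) (sub_pos.2 h).le]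

/-- A function on the line with second derivative bounded below by a positive constant which is
negative at `0` has a finite positive first exit time from the negative reals, at which it
vanishes and has positive derivative. -/
theorem exit_time_of_le_second_deriv {f g g' : ℝ → ℝ} {c : ℝ} (hf : ∀ t, HasDerivAt f (g t) t)
    (hg : ∀ t, HasDerivAt g (g' t) t) (hc : ∀ t, c ≤ g' t) (hc₀ : 0 < c) (h₀ : f 0 < 0) :
    {t : ℝ | 0 < t ∧ ¬ f t < 0}.Nonempty ∧ 0 < sInf {t : ℝ | 0 < t ∧ ¬ f t < 0} ∧
      f (sInf {t : ℝ | 0 < t ∧ ¬ f t < 0}) = 0 ∧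
      0 < g (sInf {t : ℝ | 0 < t ∧ ¬ f t < 0}) := by
  have hcont : Continuous f := continuous_iff_continuousAt.2 fun t => (hf t).continuousAt
  have hne : {t : ℝ | 0 < t ∧ ¬ f t < 0}.Nonempty := by
    set T : ℝ := 1 + 2 * (|f 0| + |g 0|) / c
    have hT : c / 2 * (T - 1) = |f 0| + |g 0| := by simp only [T]; field_simp; ring
    have hT₁ : 1 ≤ T := by simp only [T, le_add_iff_nonneg_right]; positivity
    refine ⟨T, by linarith, not_lt.2 ?_⟩
    have h := tangent_parabola_le hf hg hc 0 T
    have hkey : 0 ≤ f 0 + g 0 * T + (|f 0| + |g 0|) * T := by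
      nlinarith [neg_abs_le (f 0), neg_abs_le (g 0), abs_nonneg (f 0)]
    have hpar : c / 2 * T ^ 2 = (|f 0| + |g 0|) * T + c / 2 * T := by rw [← hT]; ring
    have : 0 ≤ c / 2 * T := by positivity
    simp only [sub_zero] at h
    linarith
  have hclosed : IsClosed {t : ℝ | 0 < t ∧ ¬ f t < 0} := by
    have he : {t : ℝ | 0 < t ∧ ¬ f t < 0} = {t : ℝ | 0 ≤ t} ∩ {t | 0 ≤ f t} := by
      ext t
      simp only [mem_ofPred_eq, mem_inter_iff, not_lt]
      refine ⟨fun h => ⟨h.1.le, h.2⟩, fun h => ⟨h.1.lt_of_ne ?_, h.2⟩⟩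
      rintro rfl
      exact h.2.not_gt h₀
    rw [he]
    exact (isClosed_le continuous_const continuous_id).inter
      (isClosed_le continuous_const hcont)
  have hbdd : BddBelow {t : ℝ | 0 < t ∧ ¬ f t < 0} := ⟨0, fun t ht => ht.1.le⟩
  have hmem := hclosed.csInf_mem hne hbdd
  have hbefore (t : ℝ) (ht₀ : 0 < t) (ht : t < sInf {t : ℝ | 0 < t ∧ ¬ f t < 0}) : f t < 0 := by
    by_contra h
    exact ht.not_ge (csInf_le hbdd ⟨ht₀, h⟩)
  set s := sInf {t : ℝ | 0 < t ∧ ¬ f t < 0}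
  obtain ⟨hs, hfs⟩ := hmem
  have hle : f s ≤ 0 := by
    refine le_of_tendsto (hcont.continuousAt.tendsto.mono_left nhdsWithin_le_nhds :
      Tendsto f (𝓝[<] s) (𝓝 (f s))) ?_
    filter_upwards [Ioo_mem_nhdsLT hs] with t ht
    exact (hbefore t ht.1 ht.2).le
  refine ⟨hne, hs, le_antisymm hle (not_lt.1 hfs), ?_⟩
  have h := tangent_parabola_le hf hg hc s 0
  by_contra! hgs
  nlinarith [mul_nonneg (neg_nonneg.2 hgs) hs.le, mul_nonneg hc₀.le (sq_nonneg s)]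

/-- in a strongly convex domain `Ω = {ζ < 0}`, a straight-line trajectory
starting inside `Ω` with nonzero velocity exits `Ω` at a finite positive time `s₁`,
reaches the boundary (`ζ = 0` there), and hits it non-tangentially
(`v·∇ζ(x₀ + s₁ v) > 0`). -/
theorem statement11 (d : ℕ) (hd : 1 ≤ d) (ζ : Eu d → ℝ) (hζ : ContDiff ℝ 2 ζ)
    (Cζ : ℝ) (hCζ : 0 < Cζ)
    (hconv : ∀ x ξ : Eu d, Cζ * ‖ξ‖ ^ 2 ≤ fderiv ℝ (fun y => fderiv ℝ ζ y ξ) x ξ)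
    (x₀ : Eu d) (hx₀ : ζ x₀ < 0) (v : Eu d) (hv : v ≠ 0) :
    {ℓ : ℝ | 0 < ℓ ∧ x₀ + ℓ • v ∉ {x : Eu d | ζ x < 0}}.Nonempty ∧
    0 < sInf {ℓ : ℝ | 0 < ℓ ∧ x₀ + ℓ • v ∉ {x : Eu d | ζ x < 0}} ∧
    ζ (x₀ + sInf {ℓ : ℝ | 0 < ℓ ∧ x₀ + ℓ • v ∉ {x : Eu d | ζ x < 0}} • v) = 0 ∧
    0 < fderiv ℝ ζ
        (x₀ + sInf {ℓ : ℝ | 0 < ℓ ∧ x₀ + ℓ • v ∉ {x : Eu d | ζ x < 0}} • v) v := by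
  have hline (t : ℝ) : HasDerivAt (fun t : ℝ => x₀ + t • v) v t := by
    simpa using ((hasDerivAt_id t).smul_const v).const_add x₀
  have hd : Differentiable ℝ fun y => fderiv ℝ ζ y v :=
    ((hζ.fderiv_right (m := 1) (by norm_num)).differentiable (by norm_num)).clm_apply
      (differentiable_const v)
  have h := exit_time_of_le_second_deriv
    (fun t => ((hζ.differentiable (by norm_num)) _).hasFDerivAt.comp_hasDerivAt t (hline t))
    (fun t => (hd _).hasFDerivAt.comp_hasDerivAt t (hline t))
    (fun t => hconv (x₀ + t • v) v)
    (by have := norm_pos_iff.2 hv; positivity) (by simpa using hx₀)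
  exact h
end
end

section
/- Let p be a real number with 0 ≤ p < 3. Then the integral ∫_{D} ∫₀^{2π} ((x·u(θ))² + 1 − |x|²)^{-p/2} dθ dx is finite, where D := {x ∈ ℝ² : |x| < 1} is the open unit disk and u(θ) := (cos θ, sin θ). Equivalently, the reciprocal chord-length function (x, u) ↦ 1/L(x,u), where L(x,u) := 2√((x·u)² + 1 − |x|²) is the length of the chord of the unit circle through x with direction u, belongs to L^p(D × S¹) for every p < 3. -/
open MeasureTheory Real Set Filter Topology
open scoped ENNReal RealInnerProductSpace

noncomputable section

/-- The weight `(1 - t²)^q` is integrable over `(-1, 1)` as soon as `q > -1`. -/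
lemma lintegral_one_sub_sq_rpow_lt_top {q : ℝ} (hq : -1 < q) :
    (∫⁻ t in Ioo (-1 : ℝ) 1, ENNReal.ofReal ((1 - t ^ 2) ^ q)) < ⊤ := by
  set r := min q 0 with hr
  have hr1 : -1 < r := lt_min hq (by norm_num)
  have h1 : IntervalIntegrable (fun t : ℝ => (1 - t) ^ r) volume (-1) 1 := by
    simpa [show (1 : ℝ) - 2 = -1 by norm_num] using
      ((intervalIntegral.intervalIntegrable_rpow' (a := 2) (b := 0) hr1).comp_sub_left 1)
  have h2 : IntervalIntegrable (fun t : ℝ => (t + 1) ^ r) volume (-1) 1 := by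
    simpa [show (2 : ℝ) - 1 = 1 by norm_num] using
      ((intervalIntegral.intervalIntegrable_rpow' (a := 0) (b := 2) hr1).comp_add_right 1)
  have h3 : IntegrableOn (fun t : ℝ => (1 - t) ^ r + (t + 1) ^ r) (Ioo (-1) 1) :=
    ((intervalIntegrable_iff_integrableOn_Ioo_of_le (by norm_num)).1 (h1.add h2))
  refine lt_of_le_of_lt (setLIntegral_mono' measurableSet_Ioo fun t ht => ?_)
    h3.lintegral_lt_top
  apply ENNReal.ofReal_le_ofReal
  obtain ⟨ha, hb⟩ := ht
  have hpos : 0 < 1 - t ^ 2 := by nlinarith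
  have hle : (1 - t ^ 2) ^ q ≤ (1 - t ^ 2) ^ r :=
    rpow_le_rpow_of_exponent_ge hpos (by nlinarith) (min_le_left _ _)
  have hA : 0 ≤ (1 - t) ^ r := rpow_nonneg (by linarith) _
  have hB : 0 ≤ (t + 1) ^ r := rpow_nonneg (by linarith) _
  rcases le_total 0 t with h | h
  · have : (1 - t ^ 2) ^ r ≤ (1 - t) ^ r :=
      rpow_le_rpow_of_nonpos (by linarith) (by nlinarith) (min_le_right _ _)
    linarith
  · have : (1 - t ^ 2) ^ r ≤ (t + 1) ^ r :=
      rpow_le_rpow_of_nonpos (by linarith) (by nlinarith) (min_le_right _ _)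
    linarith

/-- The power `-p` of the half-length of the horizontal chord of the unit circle through `v`,
extended by zero outside the open unit disk. -/
def horizontalChordWeight (p : ℝ) (v : Fin 2 → ℝ) : ℝ≥0∞ :=
  {v : Fin 2 → ℝ | v 0 ^ 2 + v 1 ^ 2 < 1}.indicator
    (fun v => ENNReal.ofReal ((1 - v 1 ^ 2) ^ (-p / 2))) v

lemma horizontalChordWeight_of_lt (p : ℝ) {v : Fin 2 → ℝ} (hv : v 0 ^ 2 + v 1 ^ 2 < 1) :
    horizontalChordWeight p v = ENNReal.ofReal ((1 - v 1 ^ 2) ^ (-p / 2)) :=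
  indicator_of_mem (s := {v : Fin 2 → ℝ | v 0 ^ 2 + v 1 ^ 2 < 1}) hv _

lemma horizontalChordWeight_of_not_lt (p : ℝ) {v : Fin 2 → ℝ}
    (hv : ¬ v 0 ^ 2 + v 1 ^ 2 < 1) : horizontalChordWeight p v = 0 :=
  indicator_of_notMem (s := {v : Fin 2 → ℝ | v 0 ^ 2 + v 1 ^ 2 < 1}) hv _

lemma measurable_horizontalChordWeight (p : ℝ) : Measurable (horizontalChordWeight p) := by
  refine Measurable.indicator (by fun_prop) ?_
  exact measurableSet_lt (by fun_prop) (by fun_prop)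

lemma lintegral_horizontalChordWeight_lt_top {p : ℝ} (hp : p < 3) :
    (∫⁻ v, horizontalChordWeight p v) < ⊤ := by
  have hm := measurable_horizontalChordWeight p
  have e := (volume_preserving_finTwoArrow ℝ).symm
  rw [← e.lintegral_comp hm, Measure.volume_eq_prod,
    lintegral_prod_symm' (fun z => horizontalChordWeight p (MeasurableEquiv.finTwoArrow.symm z))
      (hm.comp e.measurable)]
  have key : ∀ t : ℝ, (∫⁻ s : ℝ, horizontalChordWeight p
      ((MeasurableEquiv.finTwoArrow (α := ℝ)).symm (s, t))) ≤
      (Ioo (-1 : ℝ) 1).indicator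
        (fun t => 2 * ENNReal.ofReal ((1 - t ^ 2) ^ ((1 - p) / 2))) t := by
    intro t
    by_cases ht : t ∈ Ioo (-1 : ℝ) 1
    · have hpos : 0 < 1 - t ^ 2 := by nlinarith [ht.1, ht.2]
      rw [indicator_of_mem ht]
      calc _ ≤ ∫⁻ s : ℝ, (Ioo (-√(1 - t ^ 2)) (√(1 - t ^ 2))).indicator
            (fun _ => ENNReal.ofReal ((1 - t ^ 2) ^ (-p / 2))) s := by
            refine lintegral_mono fun s => ?_
            by_cases h : s ^ 2 + t ^ 2 < 1
            · have hs : s ∈ Ioo (-√(1 - t ^ 2)) (√(1 - t ^ 2)) :=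
                abs_lt.1 (lt_sqrt_of_sq_lt (by rw [sq_abs]; linarith))
              rw [horizontalChordWeight_of_lt p (by exact h),
                indicator_of_mem hs]
              rfl
            · rw [horizontalChordWeight_of_not_lt p (by exact h)]
              exact zero_le
        _ = _ := by
            rw [lintegral_indicator measurableSet_Ioo, setLIntegral_const, Real.volume_Ioo,
              ← ENNReal.ofReal_mul (by positivity), ← ENNReal.ofReal_ofNat,
              ← ENNReal.ofReal_mul (by norm_num)]
            congr 1
            rw [sqrt_eq_rpow, sub_neg_eq_add, ← two_mul, mul_left_comm, ← rpow_add hpos]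
            congr 2
            ring
    · rw [indicator_of_notMem ht, nonpos_iff_eq_zero]
      refine lintegral_eq_zero_of_ae_eq_zero (.of_forall fun s => ?_)
      refine horizontalChordWeight_of_not_lt p fun h => ht ?_
      have h' : s ^ 2 + t ^ 2 < 1 := h
      exact abs_lt.1 ((sq_lt_one_iff_abs_lt_one t).1 (by nlinarith [sq_nonneg s]))
  refine (lintegral_mono key).trans_lt ?_
  rw [lintegral_indicator measurableSet_Ioo, lintegral_const_mul' _ _ (by simp)]
  exact ENNReal.mul_lt_top (by simp) (lintegral_one_sub_sq_rpow_lt_top (by linarith))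

/-- The integral of the weight over the plane is unchanged when the plane is rotated by an
angle `-θ`. -/
lemma lintegral_horizontalChordWeight_rotate (p θ : ℝ) :
    (∫⁻ x : Eu 2, horizontalChordWeight p
      ![x 0 * Real.cos θ + x 1 * Real.sin θ, -x 0 * Real.sin θ + x 1 * Real.cos θ]) =
    ∫⁻ v, horizontalChordWeight p v := by
  set M : Matrix (Fin 2) (Fin 2) ℝ :=
    !![Real.cos θ, Real.sin θ; -Real.sin θ, Real.cos θ] with hM
  have hdet : M.det = 1 := by
    rw [hM, Matrix.det_fin_two_of]
    nlinarith [Real.sin_sq_add_cos_sq θ]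
  have hmap : Measure.map (Matrix.toLin' M) volume = volume := by
    rw [Real.map_matrix_volume_pi_eq_smul_volume_pi (by simp [hdet]), hdet]
    simp
  have hM' : Measurable (Matrix.toLin' M) :=
    (LinearMap.continuous_of_finiteDimensional _).measurable
  conv_rhs => rw [← hmap, lintegral_map (measurable_horizontalChordWeight p) hM']
  rw [← (PiLp.volume_preserving_ofLp (Fin 2)).lintegral_comp
    (f := fun v => horizontalChordWeight p (Matrix.toLin' M v))
    ((measurable_horizontalChordWeight p).comp hM')]
  refine lintegral_congr fun x => ?_
  congr 1
  ext i
  fin_cases i <;> simp [hM, Matrix.mulVec, dotProduct, Fin.sum_univ_two] <;> ring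

/-- for `0 ≤ p < 3`, the reciprocal chord length `1/L(x,u)`, where
`L(x,u) = 2√((x·u)² + 1 − |x|²)`, is `p`-integrable over the unit disk times the circle:
`∫_D ∫₀^{2π} ((x·u(θ))² + 1 − |x|²)^{−p/2} dθ dx < ∞` with `u(θ) = (cos θ, sin θ)`. -/
theorem statement16 (p : ℝ) (hp0 : 0 ≤ p) (hp : p < 3) :
    (∫⁻ x in Metric.ball (0 : Eu 2) 1, ∫⁻ θ in Ioo (0 : ℝ) (2 * π),
        ENNReal.ofReal
          (((x 0 * Real.cos θ + x 1 * Real.sin θ) ^ 2 + 1 - ‖x‖ ^ 2) ^ (-p / 2)))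
      < ⊤ := by
  have hswap := lintegral_lintegral_swap
    (μ := volume.restrict (Metric.ball (0 : Eu 2) 1))
    (ν := volume.restrict (Ioo (0 : ℝ) (2 * π)))
    (f := fun x θ => ENNReal.ofReal
      (((x 0 * Real.cos θ + x 1 * Real.sin θ) ^ 2 + 1 - ‖x‖ ^ 2) ^ (-p / 2)))
    (Measurable.aemeasurable (by unfold Function.uncurry; fun_prop))
  rw [hswap]
  have key : ∀ θ : ℝ, (∫⁻ x in Metric.ball (0 : Eu 2) 1, ENNReal.ofReal
      (((x 0 * Real.cos θ + x 1 * Real.sin θ) ^ 2 + 1 - ‖x‖ ^ 2) ^ (-p / 2))) ≤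
      ∫⁻ v, horizontalChordWeight p v := by
    intro θ
    rw [← lintegral_horizontalChordWeight_rotate p θ]
    refine (setLIntegral_mono' measurableSet_ball fun x hx => ?_).trans
      (setLIntegral_le_lintegral _ _)
    have hn : ‖x‖ ^ 2 = x 0 ^ 2 + x 1 ^ 2 := by
      simp [EuclideanSpace.norm_sq_eq, Fin.sum_univ_two]
    have hx1 : ‖x‖ ^ 2 < 1 := by
      rw [mem_ball_zero_iff] at hx
      nlinarith [norm_nonneg x]
    have hcs := Real.sin_sq_add_cos_sq θ
    have hrot : (x 0 * Real.cos θ + x 1 * Real.sin θ) ^ 2 +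
        (-x 0 * Real.sin θ + x 1 * Real.cos θ) ^ 2 = ‖x‖ ^ 2 := by
      rw [hn]
      linear_combination (x 0 ^ 2 + x 1 ^ 2) * hcs
    rw [horizontalChordWeight_of_lt p (by exact hrot.trans_lt hx1)]
    refine le_of_eq ?_
    congr 2
    simp only [Matrix.cons_val_one, Matrix.cons_val_zero]
    linarith
  refine (lintegral_mono key).trans_lt ?_
  rw [setLIntegral_const]
  exact ENNReal.mul_lt_top (lintegral_horizontalChordWeight_lt_top hp) measure_Ioo_lt_top
end
end
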